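/- arXiv:1506.03684 — 3 statements merged into one kernel-verified Lean document; each statement's English description precedes it below -/
import Mathlib

section
/- There exist universal constants c₁, c₂ > 0 with the following property. Let n ≥ 1 be an integer, H ≥ 1, ε, δ ∈ (0,1), fix a strict total order ≻ on {1,…,n}, and let F = F₁ ⊗ … ⊗ F_n be a product probability measure on ℝⁿ whose marginals F_i are atomless and supported in [1,H]. Set t = ⌈c₁·(1/ε + ln(H)/ln(1+ε))⌉ and let m ≥ c₂·(H/ε)²·(n·t·ln(n·t+2)·(1+ln(H/ε)) + ln(1/δ)). Then with probability at least 1 − δ over an i.i.d. sample v¹,…,vᵐ from F, every t-level single-item auction Â (with tie-breaking order ≻) that maximizes Σ_{j=1}^m Rev_A(vʲ) over all such t-level auctions A satisfies E_{v∼F}[Rev_Â(v)] ≥ (1−ε)·OPT(F). -/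
open MeasureTheory
open scoped ENNReal

attribute [local instance] Classical.propDecidable

/-- A `t`-level single-item auction for `n` bidders: nondecreasing thresholds
`thr i 0 ≤ thr i 1 ≤ … ≤ thr i (t-1)` for each bidder `i`. -/
structure TLevel (n t : ℕ) where
  thr : Fin n → Fin t → ℝ
  mono : ∀ i, Monotone (thr i)

namespace TLevel

/-- The level of a bid `b` for bidder `i`: the largest index `τ` with `thr i τ ≤ b`,
or `-1` if no threshold is met (computed as the number of met thresholds minus one,
which coincides with the largest met index since the thresholds are nondecreasing). -/
noncomputable def level {n t : ℕ} (A : TLevel n t) (i : Fin n) (b : ℝ) : ℤ :=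
  ((Finset.univ.filter fun τ : Fin t => A.thr i τ ≤ b).card : ℤ) - 1

/-- Bidder `i` wins: her level is ≥ 0 and she beats every other bidder, either by a
strictly higher level or by the tie-breaking order `succ` at equal levels. -/
def wins {n t : ℕ} (A : TLevel n t) (succ : Fin n → Fin n → Prop)
    (v : Fin n → ℝ) (i : Fin n) : Prop :=
  0 ≤ A.level i (v i) ∧ ∀ j : Fin n, j ≠ i →
    (A.level j (v j) < A.level i (v i) ∨
      (A.level j (v j) = A.level i (v i) ∧ succ i j))

/-- The winner's payment: the infimum over bids at which she would still win. -/
noncomputable def payment {n t : ℕ} (A : TLevel n t) (succ : Fin n → Fin n → Prop)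
    (v : Fin n → ℝ) (i : Fin n) : ℝ :=
  sInf {b : ℝ | A.wins succ (Function.update v i b) i}

/-- The revenue of the auction on profile `v`: the winner (if any) pays her
critical bid; losers pay nothing. -/
noncomputable def Rev {n t : ℕ} (A : TLevel n t) (succ : Fin n → Fin n → Prop)
    (v : Fin n → ℝ) : ℝ :=
  ∑ i : Fin n, if A.wins succ v i then A.payment succ v i else 0

end TLevel

/-- A deterministic DSIC-IR single-item auction for `n` bidders with valuations in `V`:
a measurable 0/1 allocation awarding at most one item, and measurable nonnegative payments
bounded by value times allocation, such that truthful bidding is a dominant strategy. -/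
structure SIAuction (n : ℕ) (V : Set ℝ) where
  alloc : (Fin n → ℝ) → Fin n → ℝ
  pay : (Fin n → ℝ) → Fin n → ℝ
  alloc_meas : ∀ i, Measurable fun v => alloc v i
  pay_meas : ∀ i, Measurable fun v => pay v i
  alloc01 : ∀ v i, alloc v i = 0 ∨ alloc v i = 1
  feas : ∀ v, (∑ i, alloc v i) ≤ 1
  pay_nonneg : ∀ v i, 0 ≤ pay v i
  pay_le : ∀ v, (∀ j, v j ∈ V) → ∀ i, pay v i ≤ v i * alloc v i
  dsic : ∀ v : Fin n → ℝ, (∀ j, v j ∈ V) → ∀ (i : Fin n) (b : ℝ), b ∈ V →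
    v i * alloc (Function.update v i b) i - pay (Function.update v i b) i ≤
      v i * alloc v i - pay v i

/-- `OPT n V F`: the supremum of expected revenue over all DSIC-IR single-item
auctions with valuations in `V`, for bid distribution `F`. -/
noncomputable def OPT (n : ℕ) (V : Set ℝ) (F : Measure (Fin n → ℝ)) : ℝ≥0∞ :=
  ⨆ A : SIAuction n V, ∫⁻ v, ∑ i, ENNReal.ofReal (A.pay v i) ∂F

namespace TLevel

variable {n t : ℕ} (A : TLevel n t) (succ : Fin n → Fin n → Prop)

/-- A natural number `k` is at most the level of `b` iff the `k`-th threshold exists and is met. -/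
lemma natCast_le_level_iff (i : Fin n) (b : ℝ) (k : ℕ) :
    (k : ℤ) ≤ A.level i b ↔ ∃ h : k < t, A.thr i ⟨k, h⟩ ≤ b := by
  have key : k < (Finset.univ.filter fun τ : Fin t => A.thr i τ ≤ b).card ↔
      ∃ h : k < t, A.thr i ⟨k, h⟩ ≤ b := by
    constructor
    · intro hk
      by_contra hcon
      push Not at hcon
      have hsub : ((Finset.univ.filter fun τ : Fin t => A.thr i τ ≤ b).image Fin.val) ⊆
          Finset.range k := by
        intro x hx
        simp only [Finset.mem_image, Finset.mem_filter, Finset.mem_univ, true_and] at hx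
        obtain ⟨τ, hτ, rfl⟩ := hx
        rw [Finset.mem_range]
        by_contra hle
        push Not at hle
        have hkt : k < t := lt_of_le_of_lt hle τ.2
        have := A.mono i (show (⟨k, hkt⟩ : Fin t) ≤ τ from hle)
        linarith [hcon hkt]
      have := Finset.card_le_card hsub
      rw [Finset.card_image_of_injective _ Fin.val_injective, Finset.card_range] at this
      omega
    · rintro ⟨h, hb⟩
      have hsub : Finset.Iic (⟨k, h⟩ : Fin t) ⊆
          Finset.univ.filter fun τ : Fin t => A.thr i τ ≤ b := by
        intro τ hτ
        simp only [Finset.mem_filter, Finset.mem_univ, true_and]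
        exact (A.mono i (Finset.mem_Iic.1 hτ)).trans hb
      have := Finset.card_le_card hsub
      rw [Fin.card_Iic] at this
      simpa using this
  rw [← key, level]
  omega

/-- The least level at which bidder `i` beats the others, whose levels are listed in `l`. -/
noncomputable def criticalLevel (l : Fin n → ℤ) (i : Fin n) : ℕ :=
  Finset.univ.sup fun j => if j = i then 0 else (l j + if succ i j then 0 else 1).toNat

lemma criticalLevel_update (l : Fin n → ℤ) (i : Fin n) (z : ℤ) :
    criticalLevel succ (Function.update l i z) i = criticalLevel succ l i := by
  unfold criticalLevel
  congr 1
  ext j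
  by_cases h : j = i <;> simp [h]

/-- The level profile of a valuation profile. -/
noncomputable def levels (v : Fin n → ℝ) (i : Fin n) : ℤ := A.level i (v i)

lemma levels_update (v : Fin n → ℝ) (i : Fin n) (b : ℝ) :
    A.levels (Function.update v i b) = Function.update (A.levels v) i (A.level i b) := by
  ext j
  by_cases h : j = i
  · subst h; simp [levels]
  · simp [levels, h]

lemma wins_iff (v : Fin n → ℝ) (i : Fin n) :
    A.wins succ v i ↔ (criticalLevel succ (A.levels v) i : ℤ) ≤ A.level i (v i) := by
  unfold wins
  constructor
  · rintro ⟨h0, h⟩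
    rw [← Int.toNat_of_nonneg h0]
    norm_cast
    refine Finset.sup_le fun j _ => ?_
    by_cases hj : j = i
    · simp [hj]
    · rw [if_neg hj]
      apply Int.toNat_le_toNat
      rcases h j hj with h | ⟨h, hs⟩
      · simp only [levels]; split_ifs <;> omega
      · simp only [levels, if_pos hs]; omega
  · intro h
    refine ⟨by omega, fun j hj => ?_⟩
    have h1 : (if j = i then 0 else (A.levels v j + if succ i j then 0 else 1).toNat) ≤
        criticalLevel succ (A.levels v) i :=
      Finset.le_sup (f := fun j => if j = i then 0 else
        (A.levels v j + if succ i j then 0 else 1).toNat) (Finset.mem_univ j)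
    rw [if_neg hj] at h1
    simp only [levels] at h1 h
    by_cases hs : succ i j
    · rw [if_pos hs] at h1
      simp only [hs, and_true]
      omega
    · rw [if_neg hs] at h1
      left; omega

lemma wins_update_iff (v : Fin n → ℝ) (i : Fin n) (b : ℝ) :
    A.wins succ (Function.update v i b) i ↔
      ∃ h : criticalLevel succ (A.levels v) i < t,
        A.thr i ⟨criticalLevel succ (A.levels v) i, h⟩ ≤ b := by
  rw [wins_iff, levels_update, criticalLevel_update, Function.update_self, natCast_le_level_iff]

lemma wins_iff_thr (v : Fin n → ℝ) (i : Fin n) :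
    A.wins succ v i ↔
      ∃ h : criticalLevel succ (A.levels v) i < t,
        A.thr i ⟨criticalLevel succ (A.levels v) i, h⟩ ≤ v i := by
  rw [wins_iff, natCast_le_level_iff]

lemma payment_eq (v : Fin n → ℝ) (i : Fin n) (h : criticalLevel succ (A.levels v) i < t) :
    A.payment succ v i = A.thr i ⟨criticalLevel succ (A.levels v) i, h⟩ := by
  unfold payment
  have : {b : ℝ | A.wins succ (Function.update v i b) i} =
      Set.Ici (A.thr i ⟨criticalLevel succ (A.levels v) i, h⟩) := by
    ext b
    simp [wins_update_iff, h]
  rw [this, csInf_Ici]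

/-- The payment is a function of the level profile alone. -/
noncomputable def levelPayment (l : Fin n → ℤ) (i : Fin n) : ℝ :=
  if h : criticalLevel succ l i < t then A.thr i ⟨criticalLevel succ l i, h⟩ else 0

variable {A succ} in
lemma wins.payment_eq {v : Fin n → ℝ} {i : Fin n} (h : A.wins succ v i) :
    A.payment succ v i = A.levelPayment succ (A.levels v) i := by
  obtain ⟨h, -⟩ := (A.wins_iff_thr succ v i).1 h
  rw [A.payment_eq succ v i h, levelPayment, dif_pos h]

variable {A succ} in
lemma wins.payment_le {v : Fin n → ℝ} {i : Fin n} (h : A.wins succ v i) :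
    A.payment succ v i ≤ v i := by
  obtain ⟨h, h'⟩ := (A.wins_iff_thr succ v i).1 h
  rwa [A.payment_eq succ v i h]

variable {A succ} in
lemma wins.unique [IsStrictTotalOrder (Fin n) succ] {v : Fin n → ℝ} {i j : Fin n}
    (hi : A.wins succ v i) (hj : A.wins succ v j) : i = j := by
  by_contra hij
  rcases hi.2 j (Ne.symm hij) with h | ⟨h, hs⟩ <;> rcases hj.2 i hij with h' | ⟨h', hs'⟩
  · omega
  · omega
  · omega
  · exact asymm hs hs'

variable {A succ} in
lemma wins.rev_eq [IsStrictTotalOrder (Fin n) succ] {v : Fin n → ℝ} {i : Fin n}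
    (hi : A.wins succ v i) : A.Rev succ v = A.payment succ v i := by
  unfold Rev
  rw [Finset.sum_eq_single i, if_pos hi]
  · intro j _ hj
    rw [if_neg]
    exact fun h => hj (h.unique hi)
  · simp

variable {A succ} in
lemma rev_eq_zero {v : Fin n → ℝ} (h : ∀ i, ¬ A.wins succ v i) : A.Rev succ v = 0 := by
  unfold Rev
  exact Finset.sum_eq_zero fun i _ => if_neg (h i)

lemma rev_le [IsStrictTotalOrder (Fin n) succ] {H : ℝ} (hH : 0 ≤ H) {v : Fin n → ℝ}
    (hv : ∀ i, v i ≤ H) : A.Rev succ v ≤ H := by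
  by_cases h : ∃ i, A.wins succ v i
  · obtain ⟨i, hi⟩ := h
    rw [hi.rev_eq]
    exact hi.payment_le.trans (hv i)
  · push Not at h
    rwa [rev_eq_zero h]

/-- Someone wins as soon as some level is nonnegative, and the winner has the highest level. -/
lemma exists_wins [IsStrictTotalOrder (Fin n) succ] {v : Fin n → ℝ} {i₀ : Fin n}
    (h : 0 ≤ A.level i₀ (v i₀)) :
    ∃ i, A.wins succ v i ∧ ∀ j, A.level j (v j) ≤ A.level i (v i) := by
  obtain ⟨i₁, -, hmax⟩ := Finset.exists_max_image Finset.univ (fun j => A.level j (v j))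
    ⟨i₀, Finset.mem_univ _⟩
  let s : Set (Fin n) := {j | A.level j (v j) = A.level i₁ (v i₁)}
  have hwf : WellFounded succ := Finite.wellFounded_of_trans_of_irrefl succ
  obtain ⟨i, hi, hmin⟩ := hwf.has_min s ⟨i₁, rfl⟩
  have hi' : A.level i (v i) = A.level i₁ (v i₁) := hi
  refine ⟨i, ⟨?_, fun j hj => ?_⟩, fun j => ?_⟩
  · rw [hi']; exact h.trans (hmax i₀ (Finset.mem_univ _))
  · rcases lt_or_eq_of_le (hmax j (Finset.mem_univ _)) with h1 | h1
    · left; rw [hi']; exact h1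
    · right
      refine ⟨h1.trans hi'.symm, ?_⟩
      rcases trichotomous_of succ i j with h2 | h2 | h2
      · exact h2
      · exact absurd h2.symm hj
      · exact absurd h2 (hmin j h1)
  · rw [hi']; exact hmax j (Finset.mem_univ _)

lemma measurable_level (i : Fin n) : Measurable (A.level i) := by
  have : A.level i = fun b => (∑ τ : Fin t, if A.thr i τ ≤ b then (1 : ℤ) else 0) - 1 := by
    ext b
    simp [level]
  rw [this]
  refine Measurable.sub_const (Finset.measurable_sum _ fun τ _ => ?_) _
  exact Measurable.ite measurableSet_Ici measurable_const measurable_const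

lemma measurable_levels : Measurable A.levels :=
  measurable_pi_iff.2 fun i => (A.measurable_level i).comp (measurable_pi_apply i)

lemma measurableSet_wins (i : Fin n) : MeasurableSet {v | A.wins succ v i} := by
  have : {v | A.wins succ v i} =
      A.levels ⁻¹' {l | (criticalLevel succ l i : ℤ) ≤ l i} := by
    ext v; exact A.wins_iff succ v i
  rw [this]
  exact A.measurable_levels (Set.to_countable _).measurableSet

lemma measurable_ite_payment (i : Fin n) :
    Measurable fun v => if A.wins succ v i then A.payment succ v i else 0 := by
  have : (fun v => if A.wins succ v i then A.payment succ v i else 0) =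
      fun v => if A.wins succ v i then A.levelPayment succ (A.levels v) i else 0 := by
    ext v
    split_ifs with h
    · exact h.payment_eq
    · rfl
  rw [this]
  refine Measurable.ite (A.measurableSet_wins succ i) ?_ measurable_const
  exact (measurable_of_countable fun l => A.levelPayment succ l i).comp A.measurable_levels

lemma measurable_rev : Measurable (A.Rev succ) := by
  unfold Rev
  exact Finset.measurable_sum _ fun i _ => A.measurable_ite_payment succ i

/-- Auctions that assign the same levels collect almost the same truncated revenue when their
thresholds are close. -/
lemma rev_le_rev_add [IsStrictTotalOrder (Fin n) succ] (B : TLevel n t) {H η : ℝ} (hη : 0 ≤ η)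
    {v : Fin n → ℝ} (hv : ∀ i, v i ≤ H) (hl : A.levels v = B.levels v)
    (hclose : ∀ i τ, A.thr i τ ≤ H → B.thr i τ ≤ H →
      max (A.thr i τ) 0 ≤ max (B.thr i τ) 0 + η) :
    max (A.Rev succ v) 0 ≤ max (B.Rev succ v) 0 + η := by
  by_cases h : ∃ i, A.wins succ v i
  · obtain ⟨i, hi⟩ := h
    have hi' : B.wins succ v i := by
      have := (A.wins_iff succ v i).1 hi
      rw [wins_iff, ← hl]
      exact this.trans_eq (congrFun hl i)
    rw [hi.rev_eq, hi'.rev_eq]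
    obtain ⟨h1, h2⟩ := (A.wins_iff_thr succ v i).1 hi
    obtain ⟨h3, h4⟩ := (B.wins_iff_thr succ v i).1 hi'
    rw [A.payment_eq succ v i h1, B.payment_eq succ v i h3]
    simp only [← hl] at h4 ⊢
    exact hclose _ _ (h2.trans (hv i)) (h4.trans (hv i))
  · push Not at h
    rw [rev_eq_zero h]
    simp only [max_self]
    positivity

end TLevel

/-- **Hoeffding's inequality** for i.i.d. samples of a function with values in `[0, H]`. -/
lemma hoeffding_pi {Ω : Type*} [MeasurableSpace Ω] (μ : Measure Ω) [IsProbabilityMeasure μ]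
    {f : Ω → ℝ} (hf : Measurable f) {H η : ℝ} (hH : 0 < H) (hη : 0 ≤ η)
    (hb : ∀ᵐ x ∂μ, f x ∈ Set.Icc 0 H) (m : ℕ) :
    (Measure.pi fun _ : Fin m => μ).real {S | m * η ≤ ∑ j, (f (S j) - ∫ x, f x ∂μ)} ≤
      Real.exp (-(2 * m * η ^ 2 / H ^ 2)) := by
  have hsub : ProbabilityTheory.HasSubgaussianMGF (fun x => f x - ∫ x, f x ∂μ)
      ((‖H - 0‖₊ / 2) ^ 2) μ := ProbabilityTheory.hasSubgaussianMGF_of_mem_Icc hf.aemeasurable hb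
  have hind : ProbabilityTheory.iIndepFun
      (fun (j : Fin m) (S : Fin m → Ω) => f (S j) - ∫ x, f x ∂μ) (Measure.pi fun _ => μ) :=
    ProbabilityTheory.iIndepFun_pi fun _ => (hf.sub_const _).aemeasurable
  have hsubj : ∀ j ∈ (Finset.univ : Finset (Fin m)), ProbabilityTheory.HasSubgaussianMGF
      (fun S : Fin m → Ω => f (S j) - ∫ x, f x ∂μ) ((‖H - 0‖₊ / 2) ^ 2)
      (Measure.pi fun _ => μ) := by
    intro j _
    have hmp := measurePreserving_eval (fun _ : Fin m => μ) j
    refine ProbabilityTheory.HasSubgaussianMGF.of_map (Y := fun S : Fin m → Ω => S j)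
      (X := fun x => f x - ∫ x, f x ∂μ) hmp.measurable.aemeasurable ?_
    rw [show Measure.map (fun S : Fin m → Ω => S j) (Measure.pi fun _ => μ) = μ from hmp.map_eq]
    exact hsub
  have := ProbabilityTheory.HasSubgaussianMGF.measure_sum_ge_le_of_iIndepFun hind hsubj
    (ε := m * η) (by positivity)
  refine this.trans (Real.exp_le_exp.2 (le_of_eq ?_))
  simp only [Finset.sum_const, Finset.card_univ, Fintype.card_fin, sub_zero, nsmul_eq_mul]
  push_cast
  rw [Real.norm_of_nonneg hH.le]
  rcases Nat.eq_zero_or_pos m with rfl | hm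
  · simp
  · have : (0 : ℝ) < m := by exact_mod_cast hm
    field_simp

/-- Simultaneous one-sided concentration for finitely many functions with values in `[0, H]`. -/
lemma hoeffding_pi_finite {Ω ι : Type*} [MeasurableSpace Ω] [Fintype ι] (μ : Measure Ω)
    [IsProbabilityMeasure μ] {f : ι → Ω → ℝ} (hf : ∀ g, Measurable (f g)) {H η δ : ℝ}
    (hH : 0 < H) (hη : 0 ≤ η) (hb : ∀ g, ∀ᵐ x ∂μ, f g x ∈ Set.Icc 0 H) (m : ℕ)
    (hm : Fintype.card ι * Real.exp (-(2 * m * η ^ 2 / H ^ 2)) ≤ δ) :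
    (Measure.pi fun _ : Fin m => μ)
      {S | ∃ g, m * η ≤ ∑ j, (f g (S j) - ∫ x, f g x ∂μ)} ≤ ENNReal.ofReal δ := by
  have hU : {S : Fin m → Ω | ∃ g, m * η ≤ ∑ j, (f g (S j) - ∫ x, f g x ∂μ)} =
      ⋃ g, {S | m * η ≤ ∑ j, (f g (S j) - ∫ x, f g x ∂μ)} := by
    ext S; simp
  rw [hU]
  have h1 := measureReal_iUnion_fintype_le (μ := Measure.pi fun _ : Fin m => μ)
    fun g => {S : Fin m → Ω | m * η ≤ ∑ j, (f g (S j) - ∫ x, f g x ∂μ)}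
  have h2 := Finset.sum_le_sum fun g (_ : g ∈ Finset.univ) =>
    hoeffding_pi μ (hf g) hH hη (hb g) m
  rw [Finset.sum_const, nsmul_eq_mul, Finset.card_univ] at h2
  rw [← ENNReal.ofReal_toReal (measure_ne_top (Measure.pi fun _ : Fin m => μ) _)]
  exact ENNReal.ofReal_le_ofReal ((h1.trans h2).trans hm)

/-- Averaging out one coordinate of a product probability measure. -/
lemma lintegral_pi_update {ι : Type*} [Fintype ι] [DecidableEq ι] {X : ι → Type*}
    [∀ i, MeasurableSpace (X i)] (μ : ∀ i, Measure (X i)) [∀ i, IsProbabilityMeasure (μ i)]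
    (i : ι) {f : (∀ i, X i) → ℝ≥0∞} (hf : Measurable f) :
    ∫⁻ v, f v ∂Measure.pi μ =
      ∫⁻ v, ∫⁻ x, f (Function.update v i x) ∂μ i ∂Measure.pi μ := by
  have hg : Measurable fun v => ∫⁻ x, f (Function.update v i x) ∂μ i := by
    rw [← lmarginal_singleton f i]
    exact hf.lmarginal μ
  refine lintegral_eq_of_lmarginal_eq {i} hf hg ?_
  rw [lmarginal_singleton, lmarginal_singleton]
  simp

/-- Integrals over a product can be compared one coordinate at a time. -/
lemma lintegral_pi_mono_of_update {ι : Type*} [Fintype ι] [DecidableEq ι] {X : ι → Type*}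
    [∀ i, MeasurableSpace (X i)] (μ : ∀ i, Measure (X i)) [∀ i, IsProbabilityMeasure (μ i)]
    (i : ι) {f g : (∀ i, X i) → ℝ≥0∞} (hf : Measurable f) (hg : Measurable g)
    (h : ∀ᵐ v ∂Measure.pi μ, ∫⁻ x, f (Function.update v i x) ∂μ i ≤
      ∫⁻ x, g (Function.update v i x) ∂μ i) :
    ∫⁻ v, f v ∂Measure.pi μ ≤ ∫⁻ v, g v ∂Measure.pi μ := by
  rw [lintegral_pi_update μ i hf, lintegral_pi_update μ i hg]
  exact lintegral_mono_ae h

section Tail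

variable (μ : Measure ℝ) [IsProbabilityMeasure μ]

lemma continuous_cdf_of_measure_singleton (hat : ∀ x, μ {x} = 0) :
    Continuous (ProbabilityTheory.cdf μ) := by
  rw [continuous_iff_continuousAt]
  intro x
  rw [(ProbabilityTheory.cdf μ).mono.continuousAt_iff_leftLim_eq_rightLim,
    StieltjesFunction.rightLim_eq]
  have h := (ProbabilityTheory.cdf μ).measure_singleton x
  rw [ProbabilityTheory.measure_cdf, hat x] at h
  have h1 := ENNReal.ofReal_eq_zero.1 h.symm
  have h2 := (ProbabilityTheory.cdf μ).mono.leftLim_le (le_refl x)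
  linarith

lemma measureReal_Ici_eq_one_sub_cdf (hat : ∀ x, μ {x} = 0) (p : ℝ) :
    μ.real (Set.Ici p) = 1 - ProbabilityTheory.cdf μ p := by
  have : NullSingletonClass μ := ⟨hat⟩
  rw [ProbabilityTheory.cdf_eq_real, ← probReal_compl_eq_one_sub measurableSet_Iic,
    Set.compl_Iic, measureReal_congr (Ioi_ae_eq_Ici (μ := μ) (a := p)).symm]

lemma continuous_measureReal_Ici (hat : ∀ x, μ {x} = 0) :
    Continuous fun p => μ.real (Set.Ici p) := by
  simp_rw [measureReal_Ici_eq_one_sub_cdf μ hat]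
  exact continuous_const.sub (continuous_cdf_of_measure_singleton μ hat)

lemma measure_floor_cdf_eq_le (hat : ∀ x, μ {x} = 0) {N : ℕ} (hN : 0 < N) (k : ℕ) :
    μ {x | ⌊(N : ℝ) * ProbabilityTheory.cdf μ x⌋₊ = k} ≤ ENNReal.ofReal (1 / N) := by
  have : NullSingletonClass μ := ⟨hat⟩
  have hmeas : MeasurableSet {x | ⌊(N : ℝ) * ProbabilityTheory.cdf μ x⌋₊ = k} := by
    have : Measurable fun x => ⌊(N : ℝ) * ProbabilityTheory.cdf μ x⌋₊ :=
      Nat.measurable_floor.comp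
        ((continuous_cdf_of_measure_singleton μ hat).measurable.const_mul _)
    exact this (measurableSet_singleton k)
  by_contra hlt
  push Not at hlt
  obtain ⟨K, hKs, hK, hKμ⟩ := hmeas.exists_lt_isCompact hlt
  have hne : K.Nonempty := by
    rw [Set.nonempty_iff_ne_empty]
    rintro rfl
    simp at hKμ
  obtain ⟨a, ha⟩ := hK.exists_isLeast hne
  obtain ⟨b, hb⟩ := hK.exists_isGreatest hne
  have hKab : K ⊆ Set.Icc a b := fun x hx => ⟨ha.2 hx, hb.2 hx⟩
  have hIcc : μ (Set.Icc a b) =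
      ENNReal.ofReal (ProbabilityTheory.cdf μ b - ProbabilityTheory.cdf μ a) := by
    rw [measure_congr (Ioc_ae_eq_Icc (μ := μ) (a := a) (b := b)).symm]
    conv_lhs => rw [← ProbabilityTheory.measure_cdf μ]
    rw [StieltjesFunction.measure_Ioc]
  have h1 : ENNReal.ofReal (1 / N) <
      ENNReal.ofReal (ProbabilityTheory.cdf μ b - ProbabilityTheory.cdf μ a) :=
    hIcc ▸ hKμ.trans_le (measure_mono hKab)
  have h2 := (ENNReal.ofReal_lt_ofReal_iff_of_nonneg (by positivity)).1 h1
  have hfa : ⌊(N : ℝ) * ProbabilityTheory.cdf μ a⌋₊ = k := hKs ha.1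
  have hfb : ⌊(N : ℝ) * ProbabilityTheory.cdf μ b⌋₊ = k := hKs hb.1
  have h3 : (k : ℝ) ≤ N * ProbabilityTheory.cdf μ a := by
    rw [← hfa]
    exact Nat.floor_le (mul_nonneg (Nat.cast_nonneg _) (ProbabilityTheory.cdf_nonneg μ a))
  have h4 := Nat.lt_floor_add_one ((N : ℝ) * ProbabilityTheory.cdf μ b)
  rw [hfb] at h4
  have hN' : (0 : ℝ) < N := by exact_mod_cast hN
  rw [div_lt_iff₀ hN'] at h2
  nlinarith

end Tail

lemma setLIntegral_Ici_eq_add (μ : Measure ℝ) {p q : ℝ} (h : p ≤ q) (f : ℝ → ℝ≥0∞) :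
    ∫⁻ x in Set.Ici p, f x ∂μ = ∫⁻ x in Set.Ico p q, f x ∂μ + ∫⁻ x in Set.Ici q, f x ∂μ := by
  rw [← Set.Ico_union_Ici_eq_Ici h, lintegral_union measurableSet_Ici]
  exact Set.disjoint_left.2 fun x hx hx' => not_le.2 hx.2 hx'

/-- The prices in `[0, H]` that maximize the profit of a seller with cost `c`. -/
def profitMaximizers (μ : Measure ℝ) (H c : ℝ) : Set ℝ :=
  {p | p ∈ Set.Icc 0 H ∧
    ∀ q ∈ Set.Icc 0 H, (q - c) * μ.real (Set.Ici q) ≤ (p - c) * μ.real (Set.Ici p)}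

/-- The least profit-maximizing price. -/
noncomputable def optPrice (μ : Measure ℝ) (H c : ℝ) : ℝ := sInf (profitMaximizers μ H c)

section OptPrice

variable {μ : Measure ℝ} [IsProbabilityMeasure μ] {H : ℝ}

lemma isLeast_optPrice (hat : ∀ x, μ {x} = 0) (hH : 0 ≤ H) (c : ℝ) :
    IsLeast (profitMaximizers μ H c) (optPrice μ H c) := by
  have hcont : Continuous fun q => (q - c) * μ.real (Set.Ici q) :=
    (continuous_id.sub continuous_const).mul (continuous_measureReal_Ici μ hat)
  have hclosed : IsClosed (profitMaximizers μ H c) := by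
    have : profitMaximizers μ H c = Set.Icc 0 H ∩ ⋂ q ∈ Set.Icc 0 H,
        {p | (q - c) * μ.real (Set.Ici q) ≤ (p - c) * μ.real (Set.Ici p)} := by
      ext p; simp [profitMaximizers]
    rw [this]
    exact isClosed_Icc.inter
      (isClosed_biInter fun q _ => isClosed_le continuous_const hcont)
  have hcompact : IsCompact (profitMaximizers μ H c) :=
    isCompact_Icc.of_isClosed_subset hclosed fun p hp => hp.1
  have hne : (profitMaximizers μ H c).Nonempty := by
    obtain ⟨p, hp, hmax⟩ := isCompact_Icc.exists_isMaxOn (Set.nonempty_Icc.2 hH)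
      hcont.continuousOn
    exact ⟨p, hp, fun q hq => hmax hq⟩
  exact hcompact.isLeast_sInf hne

lemma measureReal_Ici_anti {p q : ℝ} (h : p ≤ q) :
    μ.real (Set.Ici q) ≤ μ.real (Set.Ici p) :=
  measureReal_mono (Set.Ici_subset_Ici.2 h)

lemma optPrice_mono (hat : ∀ x, μ {x} = 0) (hH : 0 ≤ H) : Monotone (optPrice μ H) := by
  intro c d hcd
  have hc := isLeast_optPrice hat hH c
  have hd := isLeast_optPrice hat hH d
  by_contra hlt
  push Not at hlt
  rcases hcd.eq_or_lt with rfl | hcd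
  · exact lt_irrefl _ hlt
  have h1 := hc.1.2 _ hd.1.1
  have h2 := hd.1.2 _ hc.1.1
  have h3 := measureReal_Ici_anti (μ := μ) hlt.le
  have h4 : μ.real (Set.Ici (optPrice μ H c)) = μ.real (Set.Ici (optPrice μ H d)) := by
    nlinarith
  have h5 : μ.real (Set.Ici (optPrice μ H c)) = 0 := by
    have := measureReal_nonneg (μ := μ) (s := Set.Ici (optPrice μ H c))
    rw [← h4] at h2
    nlinarith
  have h6 : optPrice μ H d ∈ profitMaximizers μ H c := by
    refine ⟨hd.1.1, fun q hq => ?_⟩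
    have := hc.1.2 q hq
    rw [h5] at this
    rw [← h4, h5]
    linarith
  exact absurd (hc.2 h6) (not_le.2 hlt)

lemma ofReal_mul_tail (p q : ℝ) :
    ENNReal.ofReal p * μ (Set.Ici q) = ENNReal.ofReal (p * μ.real (Set.Ici q)) := by
  rw [ENNReal.ofReal_mul' measureReal_nonneg, ofReal_measureReal]

lemma measure_Ico_eq_ofReal {p q : ℝ} (h : p ≤ q) :
    μ (Set.Ico p q) = ENNReal.ofReal (μ.real (Set.Ici p) - μ.real (Set.Ici q)) := by
  rw [← Set.Ici_sdiff_Ici, ← measureReal_sdiff (Set.Ici_subset_Ici.2 h) measurableSet_Ici,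
    ofReal_measureReal]

variable {lam : ℕ → ℝ} {t : ℕ} {cnt : ℝ → ℕ}

/-- Revenue of a posted price is at most the virtual surplus computed with the upper ends of the
virtual value brackets. -/
lemma price_mul_tail_le (hat : ∀ x, μ {x} = 0) (hH : 0 ≤ H) (hlam : ∀ k, 0 ≤ lam k)
    (hmono : Monotone lam) (htop : H ≤ lam t)
    (hcnt : ∀ x k, k < cnt x ↔ k < t ∧ optPrice μ H (lam k) ≤ x) {p : ℝ}
    (hp : p ∈ Set.Icc 0 H) :
    ENNReal.ofReal p * μ (Set.Ici p) ≤ ∫⁻ x in Set.Ici p, ENNReal.ofReal (lam (cnt x)) ∂μ := by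
  have hcm : Monotone cnt := by
    intro x y hxy
    by_contra hlt
    push Not at hlt
    have h1 := (hcnt x _).1 hlt
    exact lt_irrefl _ ((hcnt y (cnt y)).2 ⟨h1.1, h1.2.trans hxy⟩)
  induction hd : t - cnt p using Nat.strong_induction_on generalizing p with
  | _ d ih =>
  rcases lt_or_ge (cnt p) t with hk | hk
  · set k := cnt p with hkdef
    set q := optPrice μ H (lam k) with hq
    have hopt := (isLeast_optPrice hat hH (lam k)).1
    have hpq : p < q := by
      by_contra hle
      push Not at hle
      exact lt_irrefl _ ((hcnt p k).2 ⟨hk, hle⟩)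
    have hkq : k < cnt q := (hcnt q k).2 ⟨hk, le_rfl⟩
    have hIH := ih (t - cnt q) (by omega) hopt.1 rfl
    rw [setLIntegral_Ici_eq_add μ hpq.le]
    have hconst : ∫⁻ x in Set.Ico p q, ENNReal.ofReal (lam (cnt x)) ∂μ =
        ENNReal.ofReal (lam k) * μ (Set.Ico p q) := by
      rw [← setLIntegral_const]
      refine setLIntegral_congr_fun measurableSet_Ico fun x hx => ?_
      have h1 : k ≤ cnt x := hcm hx.1
      have h2 : ¬ k < cnt x := fun h => not_le.2 hx.2 ((hcnt x k).1 h).2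
      simp only [show cnt x = k by omega]
    have hreal := hopt.2 p hp
    have hanti := measureReal_Ici_anti (μ := μ) hpq.le
    calc ENNReal.ofReal p * μ (Set.Ici p)
        ≤ ENNReal.ofReal (lam k) * μ (Set.Ico p q) + ENNReal.ofReal q * μ (Set.Ici q) := by
          rw [ofReal_mul_tail, ofReal_mul_tail, measure_Ico_eq_ofReal hpq.le,
            ← ENNReal.ofReal_mul (hlam k), ← ENNReal.ofReal_add
              (mul_nonneg (hlam k) (by linarith)) (mul_nonneg hopt.1.1 measureReal_nonneg)]
          apply ENNReal.ofReal_le_ofReal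
          nlinarith
      _ ≤ _ := by rw [hconst]; gcongr
  · rw [← setLIntegral_const]
    refine setLIntegral_mono' measurableSet_Ici fun x hx => ?_
    exact ENNReal.ofReal_le_ofReal
      (hp.2.trans (htop.trans (hmono (hk.trans (hcm hx)))))

/-- Revenue of an optimal price is at least the virtual surplus computed with the lower ends of
the virtual value brackets. -/
lemma lintegral_Ici_optPrice_le (hat : ∀ x, μ {x} = 0) (hH : 0 ≤ H)
    (hsupp : μ (Set.Ici H) = 0) (hlam : ∀ k, 0 ≤ lam k) (hmono : Monotone lam)
    (hcnt : ∀ x k, k < cnt x ↔ k < t ∧ optPrice μ H (lam k) ≤ x) {k : ℕ} (hk : k < t) :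
    ∫⁻ x in Set.Ici (optPrice μ H (lam k)), ENNReal.ofReal (lam (cnt x - 1)) ∂μ ≤
      ENNReal.ofReal (optPrice μ H (lam k)) * μ (Set.Ici (optPrice μ H (lam k))) := by
  induction hd : t - k using Nat.strong_induction_on generalizing k with
  | _ d ih =>
  have hopt := (isLeast_optPrice hat hH (lam k)).1
  have hge : ∀ x, optPrice μ H (lam k) ≤ x → k < cnt x := fun x hx => (hcnt x k).2 ⟨hk, hx⟩
  set p := optPrice μ H (lam k) with hpdef
  rcases lt_or_ge (k + 1) t with hk1 | hk1
  · set q := optPrice μ H (lam (k + 1)) with hq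
    have hq01 := (isLeast_optPrice hat hH (lam (k + 1))).1.1
    have hpq : p ≤ q := optPrice_mono hat hH (hmono (Nat.le_succ k))
    have hIH := ih (t - (k + 1)) (by omega) hk1 rfl
    have hconst : ∫⁻ x in Set.Ico p q, ENNReal.ofReal (lam (cnt x - 1)) ∂μ =
        ENNReal.ofReal (lam k) * μ (Set.Ico p q) := by
      rw [← setLIntegral_const]
      refine setLIntegral_congr_fun measurableSet_Ico fun x hx => ?_
      have h1 : k < cnt x := hge x hx.1
      have h2 : ¬ k + 1 < cnt x := fun h => not_le.2 hx.2 ((hcnt x (k + 1)).1 h).2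
      simp only [show cnt x - 1 = k by omega]
    have hreal := hopt.2 q hq01
    have hanti := measureReal_Ici_anti (μ := μ) hpq
    rw [setLIntegral_Ici_eq_add μ hpq, hconst]
    calc _ ≤ ENNReal.ofReal (lam k) * μ (Set.Ico p q) + ENNReal.ofReal q * μ (Set.Ici q) := by
          gcongr
      _ ≤ _ := by
          rw [ofReal_mul_tail, ofReal_mul_tail, measure_Ico_eq_ofReal hpq,
            ← ENNReal.ofReal_mul (hlam k), ← ENNReal.ofReal_add
              (mul_nonneg (hlam k) (by linarith)) (mul_nonneg hq01.1 measureReal_nonneg)]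
          apply ENNReal.ofReal_le_ofReal
          nlinarith
  · have hconst : ∫⁻ x in Set.Ici p, ENNReal.ofReal (lam (cnt x - 1)) ∂μ =
        ENNReal.ofReal (lam k) * μ (Set.Ici p) := by
      rw [← setLIntegral_const]
      refine setLIntegral_congr_fun measurableSet_Ici fun x hx => ?_
      have h1 : k < cnt x := hge x hx
      have h2 : ¬ k + 1 < cnt x := fun h => by have := ((hcnt x (k + 1)).1 h).1; omega
      simp only [show cnt x - 1 = k by omega]
    have hreal := hopt.2 H ⟨hH, le_rfl⟩
    rw [show μ.real (Set.Ici H) = 0 by simp [measureReal_def, hsupp]] at hreal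
    rw [hconst, ofReal_mul_tail, ofReal_mul_tail]
    apply ENNReal.ofReal_le_ofReal
    nlinarith

/-- The expected payment of a single bidder facing a truthful mechanism is bounded by her
virtual surplus. -/
lemma lintegral_pay_le (hat : ∀ x, μ {x} = 0) (hH : 0 ≤ H) (hsupp : μ (Set.Icc 1 H) = 1)
    (hlam : ∀ k, 0 ≤ lam k) (hmono : Monotone lam) (htop : H ≤ lam t)
    (hcnt : ∀ x k, k < cnt x ↔ k < t ∧ optPrice μ H (lam k) ≤ x) {a pay : ℝ → ℝ}
    (ha : ∀ x, a x = 0 ∨ a x = 1) (hpay0 : ∀ x, 0 ≤ pay x)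
    (hpay : ∀ x ∈ Set.Icc 1 H, pay x ≤ x * a x)
    (hdsic : ∀ x ∈ Set.Icc 1 H, ∀ b ∈ Set.Icc 1 H, x * a b - pay b ≤ x * a x - pay x) :
    ∫⁻ x, ENNReal.ofReal (pay x) ∂μ ≤ ∫⁻ x, ENNReal.ofReal (lam (cnt x) * a x) ∂μ := by
  have hae : ∀ᵐ x ∂μ, x ∈ Set.Icc 1 H :=
    (prob_compl_eq_zero_iff measurableSet_Icc).2 hsupp
  by_cases hw : ∃ w ∈ Set.Icc 1 H, a w = 1
  · obtain ⟨w, hwV, hw⟩ := hw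
    set p := pay w with hp
    have hpw : p ≤ w := by simpa [hw] using hpay w hwV
    have hpH : p ∈ Set.Icc 0 H := ⟨hpay0 w, hpw.trans hwV.2⟩
    have hne : ∀ᵐ x ∂μ, x ≠ p := by
      rw [ae_iff]; simpa using hat p
    have hchar : ∀ᵐ x ∂μ, (p ≤ x ∧ a x = 1 ∧ pay x = p) ∨ (x < p ∧ a x = 0 ∧ pay x = 0) := by
      filter_upwards [hae, hne] with x hx hxp
      have h1 := hdsic x hx w hwV
      have h2 := hdsic w hwV x hx
      have h3 := hpay x hx
      have h4 := hpay0 x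
      rcases ha x with h | h <;> rw [h] at h1 h2 h3 <;> rw [hw] at h1 h2
      · right
        exact ⟨lt_of_le_of_ne (by linarith) hxp, h, by linarith⟩
      · left
        exact ⟨by linarith, h, by linarith⟩
    calc ∫⁻ x, ENNReal.ofReal (pay x) ∂μ
        = ∫⁻ x, (Set.Ici p).indicator (fun _ => ENNReal.ofReal p) x ∂μ := by
          refine lintegral_congr_ae ?_
          filter_upwards [hchar] with x hx
          rcases hx with ⟨h1, -, h2⟩ | ⟨h1, -, h2⟩
          · simp [h1, h2]
          · simp [h1, h2]
      _ = ENNReal.ofReal p * μ (Set.Ici p) := by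
          rw [lintegral_indicator measurableSet_Ici, setLIntegral_const]
      _ ≤ ∫⁻ x in Set.Ici p, ENNReal.ofReal (lam (cnt x)) ∂μ :=
          price_mul_tail_le hat hH hlam hmono htop hcnt hpH
      _ = ∫⁻ x, ENNReal.ofReal (lam (cnt x) * a x) ∂μ := by
          rw [← lintegral_indicator measurableSet_Ici]
          refine lintegral_congr_ae ?_
          filter_upwards [hchar] with x hx
          rcases hx with ⟨h1, h2, -⟩ | ⟨h1, h2, -⟩
          · simp [h1, h2]
          · simp [h1, h2]
  · push Not at hw
    have : ∫⁻ x, ENNReal.ofReal (pay x) ∂μ = 0 := by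
      rw [← lintegral_zero (μ := μ)]
      refine lintegral_congr_ae ?_
      filter_upwards [hae] with x hx
      have h1 := hpay x hx
      rw [(ha x).resolve_right (hw x hx), mul_zero] at h1
      simpa using h1
    rw [this]
    exact zero_le

end OptPrice

section Benchmark

variable {n : ℕ} {H : ℝ} {Fi : Fin n → Measure ℝ} [∀ i, IsProbabilityMeasure (Fi i)]

lemma ae_pi_mem_Icc (hsupp : ∀ i, Fi i (Set.Icc 1 H) = 1) :
    ∀ᵐ v ∂Measure.pi Fi, ∀ i, v i ∈ Set.Icc 1 H := by
  rw [ae_all_iff]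
  intro i
  exact (Measure.quasiMeasurePreserving_eval Fi i).ae
    ((prob_compl_eq_zero_iff measurableSet_Icc).2 (hsupp i))

/-- The grid of virtual values: additive steps near zero, geometric steps further up. -/
noncomputable def virtualGrid (e : ℝ) (k : ℕ) : ℝ := (1 + e) ^ k - 1

lemma virtualGrid_succ (e : ℝ) (k : ℕ) :
    virtualGrid e (k + 1) = (1 + e) * virtualGrid e k + e := by
  simp only [virtualGrid]; ring

lemma virtualGrid_mono {e : ℝ} (he : 0 ≤ e) : Monotone (virtualGrid e) := fun _ _ h =>
  sub_le_sub_right (pow_le_pow_right₀ (by linarith) h) 1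

lemma virtualGrid_zero (e : ℝ) : virtualGrid e 0 = 0 := by simp [virtualGrid]

lemma virtualGrid_nonneg {e : ℝ} (he : 0 ≤ e) (k : ℕ) : 0 ≤ virtualGrid e k :=
  (virtualGrid_zero e).ge.trans (virtualGrid_mono he (Nat.zero_le k))

/-- The `t`-level auction whose thresholds are the optimal prices for costs on the virtual value
grid. -/
noncomputable def gridAuction (Fi : Fin n → Measure ℝ) [∀ i, IsProbabilityMeasure (Fi i)]
    (hat : ∀ i x, Fi i {x} = 0) (hH : 0 ≤ H) {e : ℝ} (he : 0 ≤ e) (t : ℕ) : TLevel n t where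
  thr i τ := optPrice (Fi i) H (virtualGrid e τ)
  mono i _ _ h := optPrice_mono (hat i) hH (virtualGrid_mono he h)

namespace TLevel

/-- The number of thresholds met by a bid. -/
noncomputable def metCount {t : ℕ} (A : TLevel n t) (i : Fin n) (b : ℝ) : ℕ :=
  (A.level i b + 1).toNat

lemma lt_metCount_iff {t : ℕ} (A : TLevel n t) (i : Fin n) (b : ℝ) (k : ℕ) :
    k < A.metCount i b ↔ (k : ℤ) ≤ A.level i b := by
  simp only [metCount]; omega

lemma measurable_comp_metCount {t : ℕ} (A : TLevel n t) (i : Fin n) {β : Type*}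
    [MeasurableSpace β] (g : ℕ → β) : Measurable fun b => g (A.metCount i b) :=
  (measurable_of_countable fun z : ℤ => g (z + 1).toNat).comp (A.measurable_level i)

lemma payment_update {t : ℕ} (A : TLevel n t) (succ : Fin n → Fin n → Prop) (v : Fin n → ℝ)
    (i : Fin n) (b : ℝ) : A.payment succ (Function.update v i b) i = A.payment succ v i := by
  simp only [payment, Function.update_idem]

end TLevel

/-- The winner of a level auction has an almost maximal virtual value. -/
lemma sum_virtualGrid_mul_le {t : ℕ} (A : TLevel n t) (succ : Fin n → Fin n → Prop)
    [IsStrictTotalOrder (Fin n) succ] {e : ℝ} (he : 0 ≤ e) (v a : Fin n → ℝ)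
    (ha : ∀ i, 0 ≤ a i) (hsum : ∑ i, a i ≤ 1) :
    ∑ i, ENNReal.ofReal (virtualGrid e (A.metCount i (v i)) * a i) ≤
      ENNReal.ofReal (1 + e) * ∑ i, (if A.wins succ v i then
        ENNReal.ofReal (virtualGrid e (A.metCount i (v i) - 1)) else 0) + ENNReal.ofReal e := by
  have hnn := virtualGrid_nonneg he
  by_cases h : ∃ i₀, 0 ≤ A.level i₀ (v i₀)
  · obtain ⟨i₀, hi₀⟩ := h
    obtain ⟨i, hi, hmax⟩ := A.exists_wins succ hi₀
    have hpos : 0 < A.metCount i (v i) := (A.lt_metCount_iff _ _ _).2 (by simpa using hi.1)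
    have hle : ∀ j, A.metCount j (v j) ≤ A.metCount i (v i) := fun j =>
      Int.toNat_le_toNat (by linarith [hmax j])
    rw [← ENNReal.ofReal_sum_of_nonneg fun j _ => mul_nonneg (hnn _) (ha j)]
    have h1 : ∑ j, virtualGrid e (A.metCount j (v j)) * a j ≤
        (1 + e) * virtualGrid e (A.metCount i (v i) - 1) + e := by
      rw [← virtualGrid_succ, Nat.sub_add_cancel hpos]
      calc _ ≤ ∑ j, virtualGrid e (A.metCount i (v i)) * a j :=
            Finset.sum_le_sum fun j _ =>
              mul_le_mul_of_nonneg_right (virtualGrid_mono he (hle j)) (ha j)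
        _ = virtualGrid e (A.metCount i (v i)) * ∑ j, a j := by rw [Finset.mul_sum]
        _ ≤ _ := mul_le_of_le_one_right (hnn _) hsum
    calc _ ≤ ENNReal.ofReal ((1 + e) * virtualGrid e (A.metCount i (v i) - 1) + e) :=
          ENNReal.ofReal_le_ofReal h1
      _ = ENNReal.ofReal (1 + e) * (if A.wins succ v i then
        ENNReal.ofReal (virtualGrid e (A.metCount i (v i) - 1)) else 0) + ENNReal.ofReal e := by
          rw [if_pos hi, ENNReal.ofReal_add (mul_nonneg (by linarith) (hnn _)) he,
            ENNReal.ofReal_mul (by linarith)]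
      _ ≤ _ := by
          gcongr
          exact Finset.single_le_sum (f := fun i => if A.wins succ v i then
            ENNReal.ofReal (virtualGrid e (A.metCount i (v i) - 1)) else 0)
            (fun _ _ => zero_le) (Finset.mem_univ i)
  · push Not at h
    have : ∀ i, A.metCount i (v i) = 0 := fun i => by
      have := h i
      simp only [TLevel.metCount]; omega
    simp [this, virtualGrid_zero]

/-- The grid auction is nearly optimal among all truthful auctions. -/
lemma OPT_le_gridAuction (succ : Fin n → Fin n → Prop) [IsStrictTotalOrder (Fin n) succ]
    (hat : ∀ i x, Fi i {x} = 0) (hH : 1 ≤ H) (hsupp : ∀ i, Fi i (Set.Icc 1 H) = 1)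
    {e : ℝ} (he : 0 ≤ e) {t : ℕ} (htop : H ≤ virtualGrid e t) :
    OPT n (Set.Icc 1 H) (Measure.pi Fi) ≤
      ENNReal.ofReal (1 + e) * ∫⁻ v, ENNReal.ofReal
        ((gridAuction Fi hat (zero_le_one.trans hH) he t).Rev succ v) ∂(Measure.pi Fi)
      + ENNReal.ofReal e := by
  have hH0 : 0 ≤ H := zero_le_one.trans hH
  set A := gridAuction Fi hat hH0 he t with hA
  have hnn := virtualGrid_nonneg he
  have hmono := virtualGrid_mono he
  have hcnt : ∀ i x k, k < A.metCount i x ↔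
      k < t ∧ optPrice (Fi i) H (virtualGrid e k) ≤ x := by
    intro i x k
    rw [TLevel.lt_metCount_iff, TLevel.natCast_le_level_iff]
    simp [hA, gridAuction]
  have htail : ∀ i, Fi i (Set.Ici H) = 0 := by
    intro i
    have h1 : Set.Ici H ⊆ {H} ∪ (Set.Icc 1 H)ᶜ := by
      intro x hx
      rcases eq_or_lt_of_le (Set.mem_Ici.1 hx) with h | h
      · left; exact h.symm
      · right; exact fun h' => not_le.2 h h'.2
    refine measure_mono_null h1 (measure_union_null (hat i H) ?_)
    exact (prob_compl_eq_zero_iff measurableSet_Icc).2 (hsupp i)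
  have hmv : ∀ i, Measurable fun v : Fin n → ℝ => virtualGrid e (A.metCount i (v i)) :=
    fun i => (A.measurable_comp_metCount i (virtualGrid e)).comp (measurable_pi_apply i)
  have hmv' : ∀ i, Measurable fun v : Fin n → ℝ =>
      ENNReal.ofReal (virtualGrid e (A.metCount i (v i) - 1)) := fun i =>
    (A.measurable_comp_metCount i fun k => ENNReal.ofReal (virtualGrid e (k - 1))).comp
      (measurable_pi_apply i)
  have hmw : ∀ i, Measurable fun v : Fin n → ℝ => if A.wins succ v i then
        ENNReal.ofReal (virtualGrid e (A.metCount i (v i) - 1)) else 0 := fun i =>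
    Measurable.ite (A.measurableSet_wins succ i) (hmv' i) measurable_const
  have hmpay : ∀ i, Measurable fun v : Fin n → ℝ =>
      ENNReal.ofReal (if A.wins succ v i then A.payment succ v i else 0) := fun i =>
    (A.measurable_ite_payment succ i).ennreal_ofReal
  have hrev : ∀ v, ∑ i, ENNReal.ofReal (if A.wins succ v i then A.payment succ v i else 0) =
      ENNReal.ofReal (A.Rev succ v) := by
    intro v
    rw [TLevel.Rev, ENNReal.ofReal_sum_of_nonneg]
    intro i _
    split_ifs with h
    · obtain ⟨h1, -⟩ := (A.wins_iff_thr succ v i).1 h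
      rw [A.payment_eq succ v i h1]
      exact (isLeast_optPrice (hat i) hH0 _).1.1.1
    · exact le_rfl
  refine iSup_le fun M => ?_
  have hupper : ∀ i, ∫⁻ v, ENNReal.ofReal (M.pay v i) ∂(Measure.pi Fi) ≤
      ∫⁻ v, ENNReal.ofReal (virtualGrid e (A.metCount i (v i)) * M.alloc v i)
        ∂(Measure.pi Fi) := by
    intro i
    refine lintegral_pi_mono_of_update Fi i (M.pay_meas i).ennreal_ofReal
      ((hmv i).mul (M.alloc_meas i)).ennreal_ofReal ?_
    filter_upwards [ae_pi_mem_Icc hsupp] with v hv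
    have hmem : ∀ x ∈ Set.Icc 1 H, ∀ j, Function.update v i x j ∈ Set.Icc 1 H := by
      intro x hx j
      by_cases h : j = i
      · subst h; simpa using hx
      · simpa [h] using hv j
    simp only [Function.update_self]
    refine lintegral_pay_le (hat i) hH0 (hsupp i) hnn hmono htop (hcnt i)
      (a := fun x => M.alloc (Function.update v i x) i)
      (pay := fun x => M.pay (Function.update v i x) i)
      (fun x => M.alloc01 _ i) (fun x => M.pay_nonneg _ i) (fun x hx => ?_)
      (fun x hx b hb => ?_)
    · simpa using M.pay_le _ (hmem x hx) i
    · simpa using M.dsic _ (hmem x hx) i b hb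
  have hlower : ∀ i, ∫⁻ v, (if A.wins succ v i then
        ENNReal.ofReal (virtualGrid e (A.metCount i (v i) - 1)) else 0) ∂(Measure.pi Fi) ≤
      ∫⁻ v, ENNReal.ofReal (if A.wins succ v i then A.payment succ v i else 0)
        ∂(Measure.pi Fi) := by
    intro i
    refine lintegral_pi_mono_of_update Fi i (hmw i) (hmpay i) (Filter.Eventually.of_forall
      fun v => ?_)
    simp only [Function.update_self, TLevel.payment_update]
    set k := TLevel.criticalLevel succ (A.levels v) i with hk
    by_cases hkt : k < t
    · have hw : ∀ x, A.wins succ (Function.update v i x) i ↔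
          x ∈ Set.Ici (optPrice (Fi i) H (virtualGrid e k)) := by
        intro x
        rw [A.wins_update_iff]
        exact ⟨fun h => h.2, fun h => ⟨hkt, h⟩⟩
      have hp : A.payment succ v i = optPrice (Fi i) H (virtualGrid e k) :=
        A.payment_eq succ v i hkt
      have h1 := lintegral_Ici_optPrice_le (hat i) hH0 (htail i) hnn hmono (hcnt i) hkt
      rw [← setLIntegral_const, ← lintegral_indicator measurableSet_Ici,
        ← lintegral_indicator measurableSet_Ici] at h1
      convert h1 using 2
      · ext x
        simp only [hw, Set.indicator_apply]
      · ext x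
        simp only [hw, Set.indicator_apply, hp]
        split_ifs <;> simp
    · have hw : ∀ x, ¬ A.wins succ (Function.update v i x) i := by
        intro x
        rw [A.wins_update_iff]
        exact fun h => hkt h.1
      simp [hw]
  calc ∫⁻ v, ∑ i, ENNReal.ofReal (M.pay v i) ∂(Measure.pi Fi)
      = ∑ i, ∫⁻ v, ENNReal.ofReal (M.pay v i) ∂(Measure.pi Fi) :=
        lintegral_finsetSum _ fun i _ => (M.pay_meas i).ennreal_ofReal
    _ ≤ ∑ i, ∫⁻ v, ENNReal.ofReal (virtualGrid e (A.metCount i (v i)) * M.alloc v i)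
        ∂(Measure.pi Fi) := Finset.sum_le_sum fun i _ => hupper i
    _ = ∫⁻ v, ∑ i, ENNReal.ofReal (virtualGrid e (A.metCount i (v i)) * M.alloc v i)
        ∂(Measure.pi Fi) := (lintegral_finsetSum _ fun i _ =>
          ((hmv i).mul (M.alloc_meas i)).ennreal_ofReal).symm
    _ ≤ ∫⁻ v, (ENNReal.ofReal (1 + e) * ∑ i, (if A.wins succ v i then
        ENNReal.ofReal (virtualGrid e (A.metCount i (v i) - 1)) else 0) + ENNReal.ofReal e)
        ∂(Measure.pi Fi) := lintegral_mono fun v =>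
          sum_virtualGrid_mul_le A succ he v (M.alloc v)
            (fun i => by rcases M.alloc01 v i with h | h <;> simp [h]) (M.feas v)
    _ = ENNReal.ofReal (1 + e) * ∑ i, ∫⁻ v, (if A.wins succ v i then
        ENNReal.ofReal (virtualGrid e (A.metCount i (v i) - 1)) else 0) ∂(Measure.pi Fi)
        + ENNReal.ofReal e := by
          rw [lintegral_add_right _ measurable_const, lintegral_const_mul _
            (Finset.measurable_sum _ fun i _ => hmw i), lintegral_finsetSum _ fun i _ => hmw i]
          simp
    _ ≤ ENNReal.ofReal (1 + e) * ∑ i, ∫⁻ v, ENNReal.ofReal (if A.wins succ v i then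
        A.payment succ v i else 0) ∂(Measure.pi Fi) + ENNReal.ofReal e := by
          gcongr ENNReal.ofReal (1 + e) * ?_ + ENNReal.ofReal e
          exact Finset.sum_le_sum fun i _ => hlower i
    _ = _ := by
          rw [← lintegral_finsetSum _ fun i _ => hmpay i]
          simp_rw [hrev]

/-- Selling to a fixed bidder at price `1` is truthful, so the optimal revenue is at least `1`. -/
lemma one_le_OPT (hn : 1 ≤ n) : 1 ≤ OPT n (Set.Icc 1 H) (Measure.pi Fi) := by
  let i₀ : Fin n := ⟨0, hn⟩
  let M : SIAuction n (Set.Icc 1 H) :=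
    { alloc := fun _ => Pi.single i₀ 1
      pay := fun _ => Pi.single i₀ 1
      alloc_meas := fun _ => measurable_const
      pay_meas := fun _ => measurable_const
      alloc01 := fun _ i => by by_cases h : i = i₀ <;> simp [h]
      feas := fun _ => by simp
      pay_nonneg := fun _ i => by by_cases h : i = i₀ <;> simp [h]
      pay_le := fun v hv i => by
        by_cases h : i = i₀
        · simpa [h] using (hv i₀).1
        · simp [h]
      dsic := fun _ _ _ _ _ => le_rfl }
  refine le_trans ?_ (le_iSup (fun A : SIAuction n (Set.Icc 1 H) =>
    ∫⁻ v, ∑ i, ENNReal.ofReal (A.pay v i) ∂Measure.pi Fi) M)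
  have : ∑ i, ENNReal.ofReal ((Pi.single i₀ (1 : ℝ) : Fin n → ℝ) i) = 1 := by
    rw [Finset.sum_eq_single i₀]
    · simp
    · intro j _ hj; simp [hj]
    · simp
  simp [M, this]

end Benchmark

section Brackets

lemma le_iff_le_of_monotone_of_ne {f : ℝ → ℕ} (hf : Monotone f) {a b x : ℝ} (hab : f a = f b)
    (hx : f x ≠ f a) : a ≤ x ↔ b ≤ x := by
  constructor
  · intro h
    by_contra hlt
    push Not at hlt
    exact hx (le_antisymm ((hf hlt.le).trans hab.ge) (hf h))
  · intro h
    by_contra hlt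
    push Not at hlt
    exact hx (le_antisymm (hf hlt.le) (hab.le.trans (hf h)))

lemma max_le_max_add_of_floor_eq {H η a b : ℝ} (hη : 0 < η) (ha : a ≤ H) (hb : b ≤ H)
    (h : ⌊max (min a H) 0 / η⌋₊ = ⌊max (min b H) 0 / η⌋₊) : max a 0 ≤ max b 0 + η := by
  rw [min_eq_left ha, min_eq_left hb] at h
  have h1 := Nat.lt_floor_add_one (max a 0 / η)
  have h2 := Nat.floor_le (show 0 ≤ max b 0 / η by positivity)
  rw [h] at h1
  have h3 : max a 0 / η < max b 0 / η + 1 := by linarith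
  rw [div_lt_iff₀ hη, add_mul, div_mul_cancel₀ _ hη.ne', one_mul] at h3
  exact h3.le

variable {n t : ℕ} {H η : ℝ} (Fi : Fin n → Measure ℝ)

/-- The quantile cell, among `N + 1`, of a real number. -/
noncomputable def quantileCell (N : ℕ) (μ : Measure ℝ) (x : ℝ) : ℕ :=
  ⌊(N : ℝ) * ProbabilityTheory.cdf μ x⌋₊

lemma quantileCell_le (N : ℕ) (μ : Measure ℝ) (x : ℝ) : quantileCell N μ x ≤ N := by
  refine Nat.floor_le_of_le ?_
  exact mul_le_of_le_one_right (Nat.cast_nonneg _) (ProbabilityTheory.cdf_le_one μ x)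

lemma quantileCell_mono (N : ℕ) (μ : Measure ℝ) : Monotone (quantileCell N μ) := fun _ _ h =>
  Nat.floor_mono (mul_le_mul_of_nonneg_left (ProbabilityTheory.monotone_cdf μ h)
    (Nat.cast_nonneg _))

/-- The cell of width `η`, after clamping to `[0, H]`, of a real number. -/
noncomputable def valueCell (H η x : ℝ) : ℕ := ⌊max (min x H) 0 / η⌋₊

lemma valueCell_le (hH : 0 ≤ H) (hη : 0 < η) (x : ℝ) : valueCell H η x ≤ ⌊H / η⌋₊ := by
  refine Nat.floor_mono ?_
  gcongr
  exact max_le (min_le_right _ _) hH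

/-- The cells of all the thresholds of a level auction. -/
noncomputable def TLevel.pattern (N : ℕ) (H η : ℝ) (A : TLevel n t) :
    Fin n → Fin t → Fin (N + 1) × Fin (⌊H / η⌋₊ + 1) := fun i τ =>
  (Fin.ofNat _ (quantileCell N (Fi i) (A.thr i τ)), Fin.ofNat _ (valueCell H η (A.thr i τ)))

variable {Fi} in
lemma quantileCell_eq_of_pattern_eq {N : ℕ} {A B : TLevel n t}
    (h : A.pattern Fi N H η = B.pattern Fi N H η) (i : Fin n) (τ : Fin t) :
    quantileCell N (Fi i) (A.thr i τ) = quantileCell N (Fi i) (B.thr i τ) := by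
  have := congrArg (fun g => ((g i τ).1 : ℕ)) h
  simpa [TLevel.pattern, Nat.mod_eq_of_lt (Nat.lt_succ_of_le (quantileCell_le _ _ _))] using this

variable {Fi} in
lemma valueCell_eq_of_pattern_eq {N : ℕ} (hH : 0 ≤ H) (hη : 0 < η) {A B : TLevel n t}
    (h : A.pattern Fi N H η = B.pattern Fi N H η) (i : Fin n) (τ : Fin t) :
    valueCell H η (A.thr i τ) = valueCell H η (B.thr i τ) := by
  have := congrArg (fun g => ((g i τ).2 : ℕ)) h
  simpa [TLevel.pattern, Nat.mod_eq_of_lt (Nat.lt_succ_of_le (valueCell_le hH hη _))] using this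

/-- The profiles in which some value shares a quantile cell with a threshold. -/
def collisionSet (N : ℕ) (A : TLevel n t) : Set (Fin n → ℝ) :=
  {v | ∃ i τ, quantileCell N (Fi i) (v i) = quantileCell N (Fi i) (A.thr i τ)}

lemma collisionSet_eq_iUnion (N : ℕ) (A : TLevel n t) :
    collisionSet Fi N A = ⋃ i, ⋃ τ, Function.eval i ⁻¹'
      {x | quantileCell N (Fi i) x = quantileCell N (Fi i) (A.thr i τ)} := by
  ext v; simp [collisionSet]

variable {Fi} in
lemma collisionSet_eq_of_pattern_eq {N : ℕ} {A B : TLevel n t}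
    (h : A.pattern Fi N H η = B.pattern Fi N H η) :
    collisionSet Fi N A = collisionSet Fi N B := by
  ext v; simp [collisionSet, quantileCell_eq_of_pattern_eq h]

variable {Fi} in
lemma levels_eq_of_pattern_eq {N : ℕ} {A B : TLevel n t}
    (h : A.pattern Fi N H η = B.pattern Fi N H η) {v : Fin n → ℝ}
    (hv : v ∉ collisionSet Fi N A) : A.levels v = B.levels v := by
  ext i
  simp only [TLevel.levels, TLevel.level]
  congr 3
  ext τ
  simp only [Finset.mem_filter, Finset.mem_univ, true_and]
  exact le_iff_le_of_monotone_of_ne (quantileCell_mono N (Fi i))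
    (quantileCell_eq_of_pattern_eq h i τ) fun h' => hv ⟨i, τ, h'⟩

/-- An upper bound for the truncated revenue of every auction with the same pattern as `A`. -/
noncomputable def upperRev (succ : Fin n → Fin n → Prop) (N : ℕ) (H η : ℝ) (A : TLevel n t)
    (v : Fin n → ℝ) : ℝ :=
  if v ∈ collisionSet Fi N A then H else min H (max (A.Rev succ v) 0 + η)

variable (succ : Fin n → Fin n → Prop)

lemma upperRev_mem_Icc (hH : 0 ≤ H) (hη : 0 ≤ η) (N : ℕ) (A : TLevel n t) (v : Fin n → ℝ) :
    upperRev Fi succ N H η A v ∈ Set.Icc 0 H := by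
  unfold upperRev
  split_ifs
  · exact ⟨hH, le_rfl⟩
  · exact ⟨le_min hH (by positivity), min_le_left _ _⟩

lemma max_rev_le_upperRev [IsStrictTotalOrder (Fin n) succ] {N : ℕ} (hH : 0 ≤ H) (hη : 0 < η)
    {A B : TLevel n t}
    (h : A.pattern Fi N H η = B.pattern Fi N H η) {v : Fin n → ℝ} (hv : ∀ i, v i ≤ H) :
    max (A.Rev succ v) 0 ≤ upperRev Fi succ N H η B v := by
  have hle : max (A.Rev succ v) 0 ≤ H := max_le (A.rev_le succ hH hv) hH
  unfold upperRev
  split_ifs with hc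
  · exact hle
  · refine le_min hle ?_
    rw [← collisionSet_eq_of_pattern_eq h] at hc
    exact A.rev_le_rev_add succ B hη.le hv (levels_eq_of_pattern_eq h hc) fun i τ ha hb =>
      max_le_max_add_of_floor_eq hη ha hb (valueCell_eq_of_pattern_eq hH hη h i τ)

variable [∀ i, IsProbabilityMeasure (Fi i)]

lemma measurableSet_quantileCell_eq (hat : ∀ i x, Fi i {x} = 0) (N : ℕ) (i : Fin n) (k : ℕ) :
    MeasurableSet {x | quantileCell N (Fi i) x = k} := by
  have : Measurable fun x => quantileCell N (Fi i) x :=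
    Nat.measurable_floor.comp
      ((continuous_cdf_of_measure_singleton (Fi i) (hat i)).measurable.const_mul _)
  exact this (measurableSet_singleton k)

lemma measurableSet_collisionSet (hat : ∀ i x, Fi i {x} = 0) (N : ℕ) (A : TLevel n t) :
    MeasurableSet (collisionSet Fi N A) := by
  rw [collisionSet_eq_iUnion]
  exact MeasurableSet.iUnion fun i => MeasurableSet.iUnion fun τ =>
    measurable_pi_apply i (measurableSet_quantileCell_eq Fi hat N i _)

lemma measureReal_collisionSet_le (hat : ∀ i x, Fi i {x} = 0) {N : ℕ} (hN : 0 < N)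
    (A : TLevel n t) : (Measure.pi Fi).real (collisionSet Fi N A) ≤ n * t / N := by
  rw [collisionSet_eq_iUnion]
  have h1 : ∀ i τ, (Measure.pi Fi).real (Function.eval i ⁻¹'
      {x | quantileCell N (Fi i) x = quantileCell N (Fi i) (A.thr i τ)}) ≤ 1 / N := by
    intro i τ
    rw [(measurePreserving_eval Fi i).measureReal_preimage
      (measurableSet_quantileCell_eq Fi hat N i _).nullMeasurableSet]
    exact ENNReal.toReal_le_of_le_ofReal (by positivity)
      (measure_floor_cdf_eq_le (Fi i) (hat i) hN _)
  calc _ ≤ ∑ i, (Measure.pi Fi).real (⋃ τ, Function.eval i ⁻¹'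
      {x | quantileCell N (Fi i) x = quantileCell N (Fi i) (A.thr i τ)}) :=
        measureReal_iUnion_fintype_le _
    _ ≤ ∑ i : Fin n, ∑ τ : Fin t, (1 / N : ℝ) := by
        refine Finset.sum_le_sum fun i _ => (measureReal_iUnion_fintype_le _).trans ?_
        exact Finset.sum_le_sum fun τ _ => h1 i τ
    _ = n * t / N := by simp; ring

lemma measurable_upperRev (hat : ∀ i x, Fi i {x} = 0) (N : ℕ) (A : TLevel n t) :
    Measurable (upperRev Fi succ N H η A) :=
  Measurable.ite (measurableSet_collisionSet Fi hat N A) measurable_const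
    (measurable_const.min (((A.measurable_rev succ).max measurable_const).add_const _))

variable [IsStrictTotalOrder (Fin n) succ]

lemma integrable_max_rev (hH : 1 ≤ H) (hsupp : ∀ i, Fi i (Set.Icc 1 H) = 1) (A : TLevel n t) :
    Integrable (fun v => max (A.Rev succ v) 0) (Measure.pi Fi) := by
  refine Integrable.of_mem_Icc 0 H ((A.measurable_rev succ).max measurable_const).aemeasurable ?_
  filter_upwards [ae_pi_mem_Icc hsupp] with v hv
  have hH0 : 0 ≤ H := zero_le_one.trans hH
  exact ⟨le_max_right _ _, max_le (A.rev_le succ hH0 fun i => (hv i).2) hH0⟩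

lemma integral_upperRev_le (hat : ∀ i x, Fi i {x} = 0) (hH : 1 ≤ H)
    (hsupp : ∀ i, Fi i (Set.Icc 1 H) = 1) (hη : 0 < η) {N : ℕ} (hN : 0 < N)
    (hN' : n * t * H / η ≤ N) {A B : TLevel n t}
    (h : A.pattern Fi N H η = B.pattern Fi N H η) :
    ∫ v, upperRev Fi succ N H η B v ∂Measure.pi Fi ≤
      ∫ v, max (A.Rev succ v) 0 ∂Measure.pi Fi + 3 * η := by
  have hH0 : 0 ≤ H := zero_le_one.trans hH
  have hmD := measurableSet_collisionSet Fi hat N B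
  have hintA := integrable_max_rev Fi succ hH hsupp A
  have hintD : Integrable ((collisionSet Fi N B).indicator fun _ => H) (Measure.pi Fi) :=
    (integrable_const H).indicator hmD
  have hintU : Integrable (upperRev Fi succ N H η B) (Measure.pi Fi) :=
    Integrable.of_mem_Icc 0 H (measurable_upperRev Fi succ hat N B).aemeasurable
      (Filter.Eventually.of_forall fun v => upperRev_mem_Icc Fi succ hH0 hη.le N B v)
  have hpt : ∀ᵐ v ∂Measure.pi Fi, upperRev Fi succ N H η B v ≤
      (max (A.Rev succ v) 0 + 2 * η) + (collisionSet Fi N B).indicator (fun _ => H) v := by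
    filter_upwards [ae_pi_mem_Icc hsupp] with v hv
    unfold upperRev
    split_ifs with hc
    · rw [Set.indicator_of_mem hc]
      have : 0 ≤ max (A.Rev succ v) 0 := le_max_right _ _
      linarith
    · rw [Set.indicator_of_notMem hc]
      have := B.rev_le_rev_add succ A hη.le (fun i => (hv i).2)
        (levels_eq_of_pattern_eq h.symm hc) fun i τ ha hb =>
          max_le_max_add_of_floor_eq hη ha hb (valueCell_eq_of_pattern_eq hH0 hη h.symm i τ)
      have := min_le_right H (max (B.Rev succ v) 0 + η)
      linarith
  have hintA2 : Integrable (fun v => max (A.Rev succ v) 0 + 2 * η) (Measure.pi Fi) :=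
    hintA.add (integrable_const _)
  refine (integral_mono_ae hintU (hintA2.add hintD) hpt).trans ?_
  rw [integral_add' hintA2 hintD, integral_add hintA (integrable_const _),
    integral_indicator_const _ hmD]
  have h2 := measureReal_collisionSet_le Fi hat hN B
  have hN0 : (0 : ℝ) < N := by exact_mod_cast hN
  have h3 : (n * t / N : ℝ) * H ≤ η := by
    rw [div_le_iff₀ hη] at hN'
    rw [div_mul_eq_mul_div, div_le_iff₀ hN0]
    linarith
  have h4 := mul_le_mul_of_nonneg_right h2 hH0
  simp only [integral_const, probReal_univ, smul_eq_mul, one_mul]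
  linarith

/-- With high probability, every empirical revenue maximizer competes with a given auction. -/
lemma measure_erm_ge (hat : ∀ i x, Fi i {x} = 0) (hH : 1 ≤ H)
    (hsupp : ∀ i, Fi i (Set.Icc 1 H) = 1) (hη : 0 < η) {N : ℕ} (hN : 0 < N)
    (hN' : n * t * H / η ≤ N) {m : ℕ} (hm : 0 < m) {δ : ℝ} (hδ : 0 ≤ δ)
    (hcard : ((((N + 1) * (⌊H / η⌋₊ + 1)) ^ t) ^ n + 1 : ℝ) *
      Real.exp (-(2 * m * η ^ 2 / H ^ 2)) ≤ δ)
    (B : TLevel n t) (hB : ∀ v, 0 ≤ B.Rev succ v) :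
    ENNReal.ofReal (1 - δ) ≤ (Measure.pi fun _ : Fin m => Measure.pi Fi)
      {S | ∀ A : TLevel n t, (∑ j, B.Rev succ (S j)) ≤ ∑ j, A.Rev succ (S j) →
        ∫ v, B.Rev succ v ∂Measure.pi Fi ≤ ∫ v, max (A.Rev succ v) 0 ∂Measure.pi Fi + 5 * η} := by
  have hH0 : 0 < H := zero_lt_one.trans_le hH
  let P := Fin n → Fin t → Fin (N + 1) × Fin (⌊H / η⌋₊ + 1)
  let rep : P → TLevel n t := fun g =>
    if h : ∃ A : TLevel n t, A.pattern Fi N H η = g then h.choose else B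
  have hrep : ∀ A : TLevel n t,
      A.pattern Fi N H η = (rep (A.pattern Fi N H η)).pattern Fi N H η := by
    intro A
    have h : ∃ A' : TLevel n t, A'.pattern Fi N H η = A.pattern Fi N H η := ⟨A, rfl⟩
    simp only [rep, dif_pos h]
    exact h.choose_spec.symm
  let f : Option P → (Fin n → ℝ) → ℝ := fun o => o.elim (fun v => H - B.Rev succ v)
    fun g => upperRev Fi succ N H η (rep g)
  have hf : ∀ o, Measurable (f o) := by
    rintro (_ | g)
    · exact measurable_const.sub (B.measurable_rev succ)
    · exact measurable_upperRev Fi succ hat N (rep g)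
  have hfb : ∀ o, ∀ᵐ v ∂Measure.pi Fi, f o v ∈ Set.Icc 0 H := by
    rintro (_ | g)
    · filter_upwards [ae_pi_mem_Icc hsupp] with v hv
      have h1 := B.rev_le succ hH0.le fun i => (hv i).2
      have h2 := hB v
      exact ⟨sub_nonneg.2 h1, sub_le_self _ h2⟩
    · exact Filter.Eventually.of_forall fun v => upperRev_mem_Icc Fi succ hH0.le hη.le N (rep g) v
  have hcardP : (Fintype.card (Option P) : ℝ) =
      (((N + 1) * (⌊H / η⌋₊ + 1)) ^ t) ^ n + 1 := by
    simp [P, Fintype.card_option]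
  have hbad := hoeffding_pi_finite (δ := δ) (Measure.pi Fi) hf hH0 hη.le hfb m (by rwa [hcardP])
  have hsample : ∀ᵐ S ∂(Measure.pi fun _ : Fin m => Measure.pi Fi),
      ∀ j i, S j i ∈ Set.Icc 1 H := by
    rw [ae_all_iff]
    intro j
    exact (Measure.quasiMeasurePreserving_eval (fun _ : Fin m => Measure.pi Fi) j).ae
      (ae_pi_mem_Icc hsupp)
  set good := {S : Fin m → Fin n → ℝ | ∀ A : TLevel n t,
    (∑ j, B.Rev succ (S j)) ≤ ∑ j, A.Rev succ (S j) →
    ∫ v, B.Rev succ v ∂Measure.pi Fi ≤ ∫ v, max (A.Rev succ v) 0 ∂Measure.pi Fi + 5 * η}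
    with hgood
  have hcover : (Set.univ : Set (Fin m → Fin n → ℝ)) ⊆
      (good ∪ {S | ∃ o, m * η ≤ ∑ j, (f o (S j) - ∫ x, f o x ∂Measure.pi Fi)}) ∪
        {S | ∀ j i, S j i ∈ Set.Icc 1 H}ᶜ := by
    intro S _
    by_cases hS : ∀ j i, S j i ∈ Set.Icc 1 H
    swap
    · exact Or.inr hS
    by_cases hS' : ∃ o, m * η ≤ ∑ j, (f o (S j) - ∫ x, f o x ∂Measure.pi Fi)
    · exact Or.inl (Or.inr hS')
    refine Or.inl (Or.inl fun A hA => ?_)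
    push Not at hS'
    have hm0 : (0 : ℝ) < m := by exact_mod_cast hm
    have hintB : Integrable (fun v => B.Rev succ v) (Measure.pi Fi) := by
      have := integrable_max_rev Fi succ hH hsupp B
      simpa only [max_eq_left (hB _)] using this
    have h1 := hS' none
    have h2 := hS' (some (A.pattern Fi N H η))
    simp only [f, Option.elim, Finset.sum_sub_distrib, Finset.sum_const, Finset.card_univ,
      Fintype.card_fin, nsmul_eq_mul] at h1 h2
    rw [integral_sub (integrable_const H) hintB] at h1
    simp only [integral_const, probReal_univ, smul_eq_mul, one_mul] at h1
    have h3 := integral_upperRev_le Fi succ hat hH hsupp hη hN hN' (hrep A)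
    have h4 : ∑ j, A.Rev succ (S j) ≤
        ∑ j, upperRev Fi succ N H η (rep (A.pattern Fi N H η)) (S j) :=
      Finset.sum_le_sum fun j _ => (le_max_left _ _).trans
        (max_rev_le_upperRev Fi succ hH0.le hη (hrep A) fun i => (hS j i).2)
    have h5 := mul_le_mul_of_nonneg_left h3 hm0.le
    have h6 : (m : ℝ) * ∫ v, B.Rev succ v ∂Measure.pi Fi ≤
        m * (∫ v, max (A.Rev succ v) 0 ∂Measure.pi Fi + 5 * η) := by
      linarith
    exact le_of_mul_le_mul_left h6 hm0
  have hone : (1 : ℝ≥0∞) ≤ (Measure.pi fun _ : Fin m => Measure.pi Fi) good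
      + ENNReal.ofReal δ := by
    calc (1 : ℝ≥0∞) = (Measure.pi fun _ : Fin m => Measure.pi Fi) Set.univ := by simp
      _ ≤ _ := measure_mono hcover
      _ ≤ _ := measure_union_le _ _
      _ = (Measure.pi fun _ : Fin m => Measure.pi Fi) (good ∪
          {S | ∃ o, m * η ≤ ∑ j, (f o (S j) - ∫ x, f o x ∂Measure.pi Fi)}) := by
        rw [show (Measure.pi fun _ : Fin m => Measure.pi Fi)
          {S | ∀ j i, S j i ∈ Set.Icc 1 H}ᶜ = 0 from hsample, add_zero]
      _ ≤ _ := (measure_union_le _ _).trans (by gcongr)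
  rw [ENNReal.ofReal_sub _ hδ, ENNReal.ofReal_one]
  exact tsub_le_iff_right.2 hone

end Brackets

/-- The union bound over threshold patterns is absorbed by the sample size. -/
lemma card_pattern_mul_exp_le {n t m : ℕ} (hn : 1 ≤ n) (ht : 1 ≤ t) {H ε δ : ℝ} (hH : 1 ≤ H)
    (hε : ε ∈ Set.Ioo (0 : ℝ) 1) (hδ : 0 < δ) (hδ1 : δ < 1)
    (hm : 288 * (H / ε) ^ 2 *
      (n * t * Real.log (n * t + 2) * (1 + Real.log (H / ε)) + Real.log (1 / δ)) ≤ m) :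
    ((((⌈n * t * H / (ε / 8)⌉₊ + 1) * (⌊H / (ε / 8)⌋₊ + 1)) ^ t) ^ n + 1 : ℝ) *
      Real.exp (-(2 * m * (ε / 8) ^ 2 / H ^ 2)) ≤ δ := by
  obtain ⟨hε0, hε1⟩ := hε
  have hH0 : 0 < H := zero_lt_one.trans_le hH
  set h := H / ε with hh
  have hh1 : 1 ≤ h := by rw [hh, le_div_iff₀ hε0]; linarith
  set a : ℝ := n * t with ha
  have ha1 : 1 ≤ a := by
    have h1 : (1 : ℝ) ≤ n := by exact_mod_cast hn
    have h2 : (1 : ℝ) ≤ t := by exact_mod_cast ht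
    nlinarith
  have hdiv : H / (ε / 8) = 8 * h := by rw [hh]; field_simp
  have hdiv' : a * H / (ε / 8) = 8 * (a * h) := by rw [hh]; field_simp
  have hah : 1 ≤ a * h := by nlinarith
  have hN : (⌈a * H / (ε / 8)⌉₊ : ℝ) + 1 ≤ 10 * (a * h) := by
    have := Nat.ceil_lt_add_one (show 0 ≤ a * H / (ε / 8) by positivity)
    rw [hdiv'] at this ⊢
    linarith
  have hR : (⌊H / (ε / 8)⌋₊ : ℝ) + 1 ≤ 9 * h := by
    have := Nat.floor_le (show 0 ≤ H / (ε / 8) by positivity)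
    rw [hdiv] at this ⊢
    linarith
  set X := Real.log (a + 2) with hX
  have hX1 : 1 ≤ X := by
    rw [hX, Real.le_log_iff_exp_le (by linarith)]
    linarith [Real.exp_one_lt_d9]
  set Y := 1 + Real.log h with hY
  have hlogh : 0 ≤ Real.log h := Real.log_nonneg hh1
  have hY1 : 1 ≤ Y := by linarith
  have hXY : 1 ≤ X * Y := by nlinarith
  have hcell : ((⌈a * H / (ε / 8)⌉₊ : ℝ) + 1) * ((⌊H / (ε / 8)⌋₊ : ℝ) + 1) ≤
      Real.exp (8 * (X * Y)) := by
    have hexp5 : (90 : ℝ) ≤ Real.exp 5 := by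
      have h1 : Real.exp 5 = Real.exp 1 ^ 5 := by rw [← Real.exp_nat_mul]; norm_num
      have h2 : (2.7 : ℝ) ^ 5 ≤ Real.exp 1 ^ 5 :=
        pow_le_pow_left₀ (by norm_num) (by linarith [Real.exp_one_gt_d9]) 5
      rw [h1]
      norm_num at h2 ⊢
      linarith
    have hexpX : Real.exp X = a + 2 := Real.exp_log (by linarith)
    have hexph : Real.exp (Real.log h) = h := Real.exp_log (by linarith)
    calc _ ≤ (10 * (a * h)) * (9 * h) := by gcongr
      _ = 90 * a * (h * h) := by ring
      _ ≤ Real.exp 5 * (a + 2) * (h * h) := by gcongr; linarith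
      _ = Real.exp (5 + X + (Real.log h + Real.log h)) := by
          rw [Real.exp_add, Real.exp_add, Real.exp_add, hexpX, hexph]
      _ ≤ _ := Real.exp_le_exp.2 (by nlinarith)
  set M := ((⌈a * H / (ε / 8)⌉₊ : ℝ) + 1) * ((⌊H / (ε / 8)⌋₊ : ℝ) + 1) with hM
  have hM1 : 1 ≤ M := by
    have h1 : (0 : ℝ) ≤ ⌈a * H / (ε / 8)⌉₊ := Nat.cast_nonneg _
    have h2 : (0 : ℝ) ≤ ⌊H / (ε / 8)⌋₊ := Nat.cast_nonneg _
    rw [hM]; nlinarith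
  have hpow : (M ^ t) ^ n ≤ Real.exp (8 * (a * X * Y)) := by
    calc (M ^ t) ^ n ≤ (Real.exp (8 * (X * Y)) ^ t) ^ n := by gcongr
      _ = Real.exp (8 * (a * X * Y)) := by
          rw [← Real.exp_nat_mul, ← Real.exp_nat_mul, ha]; congr 1; ring
  have hpow1 : 1 ≤ (M ^ t) ^ n := one_le_pow₀ (one_le_pow₀ hM1)
  have hcount : (M ^ t) ^ n + 1 ≤ Real.exp (9 * (a * X * Y)) := by
    have h2 : (2 : ℝ) ≤ Real.exp (a * X * Y) := by
      have h3 := Real.add_one_le_exp (a * X * Y)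
      nlinarith
    calc (M ^ t) ^ n + 1 ≤ 2 * (M ^ t) ^ n := by linarith
      _ ≤ Real.exp (a * X * Y) * Real.exp (8 * (a * X * Y)) := by gcongr
      _ = _ := by rw [← Real.exp_add]; congr 1; ring
  have hL : 0 ≤ Real.log (1 / δ) := Real.log_nonneg (by rw [le_div_iff₀ hδ]; linarith)
  have hsize : 9 * (a * X * Y + Real.log (1 / δ)) ≤ 2 * m * (ε / 8) ^ 2 / H ^ 2 := by
    have h1 : 2 * m * (ε / 8) ^ 2 / H ^ 2 = m / (32 * h ^ 2) := by
      rw [hh]; field_simp; ring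
    rw [h1, le_div_iff₀ (by positivity)]
    linarith
  calc _ ≤ Real.exp (9 * (a * X * Y)) * Real.exp (-(9 * (a * X * Y + Real.log (1 / δ)))) := by
        gcongr
    _ = Real.exp (-(9 * Real.log (1 / δ))) := by rw [← Real.exp_add]; congr 1; ring
    _ ≤ Real.exp (-Real.log (1 / δ)) := Real.exp_le_exp.2 (by linarith)
    _ = δ := by rw [one_div, Real.log_inv, neg_neg, Real.exp_log hδ]

/-- The prescribed number of levels lets the virtual value grid reach `H`. -/
lemma le_virtualGrid {H ε : ℝ} (hH : 1 ≤ H) (hε : ε ∈ Set.Ioo (0 : ℝ) 1) {t : ℕ}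
    (ht : 16 * (1 / ε + Real.log H / Real.log (1 + ε)) ≤ t) :
    H ≤ virtualGrid (ε / 8) t := by
  obtain ⟨hε0, hε1⟩ := hε
  have hlogH : 0 ≤ Real.log H := Real.log_nonneg hH
  have hlog : 0 < Real.log (1 + ε) := Real.log_pos (by linarith)
  have h1 : Real.log (1 + ε) ≤ 8 * Real.log (1 + ε / 8) := by
    have hb := one_add_mul_le_pow (show (-2 : ℝ) ≤ ε / 8 by linarith) 8
    have := Real.log_le_log (show 0 < 1 + ε by linarith)
      (show 1 + ε ≤ (1 + ε / 8) ^ 8 by norm_num at hb ⊢; linarith)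
    rwa [Real.log_pow] at this
  have h2 : ε / 16 ≤ Real.log (1 + ε / 8) := by
    have h := Real.one_sub_inv_le_log_of_pos (show 0 < 1 + ε / 8 by linarith)
    refine le_trans ?_ h
    rw [le_sub_iff_add_le, ← le_sub_iff_add_le', inv_le_comm₀ (by linarith) (by linarith),
      inv_eq_one_div, div_le_iff₀ (by linarith)]
    nlinarith
  have hl8 : 0 ≤ Real.log (1 + ε / 8) := by linarith
  have h3 : Real.log (H + 1) ≤ t * Real.log (1 + ε / 8) := by
    have h4 : Real.log (H + 1) ≤ 1 + Real.log H := by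
      rw [Real.log_le_iff_le_exp (by linarith), Real.exp_add, Real.exp_log (by linarith)]
      nlinarith [Real.exp_one_gt_d9]
    have h5 := mul_le_mul_of_nonneg_right ht hl8
    have h6 : 1 ≤ 16 * (1 / ε * Real.log (1 + ε / 8)) := by
      have := mul_le_mul_of_nonneg_left h2 (show 0 ≤ 1 / ε by positivity)
      have h7 : 1 / ε * (ε / 16) = 1 / 16 := by field_simp
      linarith
    have h8 : Real.log H ≤ 16 * (Real.log H / Real.log (1 + ε) * Real.log (1 + ε / 8)) := by
      have h9 : Real.log H = Real.log H / Real.log (1 + ε) * Real.log (1 + ε) := by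
        field_simp
      have h10 := mul_le_mul_of_nonneg_left h1
        (show 0 ≤ Real.log H / Real.log (1 + ε) by positivity)
      have h11 : 0 ≤ Real.log H / Real.log (1 + ε) * Real.log (1 + ε / 8) := by positivity
      linarith
    linarith
  rw [← Real.log_pow] at h3
  have h4 := (Real.log_le_log_iff (by linarith) (by positivity)).1 h3
  rw [virtualGrid]
  linarith

/-- Sample complexity of learning a near-optimal single-item auction: there are
universal constants `c₁, c₂ > 0` such that, for valuations drawn from a product
distribution with atomless marginals supported in `[1,H]`, with
`t = ⌈c₁(1/ε + ln H / ln(1+ε))⌉` and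
`m ≥ c₂ (H/ε)² (n t ln(nt+2)(1 + ln(H/ε)) + ln(1/δ))` i.i.d. samples, with probability
at least `1 - δ` every empirical-revenue-maximizing `t`-level auction obtains expected
revenue at least `(1-ε)` times optimal. -/
theorem sample_complexity_tlevel_single_item :
    ∃ c₁ c₂ : ℝ, 0 < c₁ ∧ 0 < c₂ ∧
      ∀ n : ℕ, 1 ≤ n →
      ∀ H : ℝ, 1 ≤ H →
      ∀ ε δ : ℝ, ε ∈ Set.Ioo (0 : ℝ) 1 → δ ∈ Set.Ioo (0 : ℝ) 1 →
      ∀ succ : Fin n → Fin n → Prop, IsStrictTotalOrder (Fin n) succ →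
      ∀ Fi : Fin n → Measure ℝ,
        (∀ i, IsProbabilityMeasure (Fi i)) →
        (∀ i, ∀ x : ℝ, Fi i {x} = 0) →
        (∀ i, Fi i (Set.Icc 1 H) = 1) →
      ∀ t : ℕ, t = ⌈c₁ * (1 / ε + Real.log H / Real.log (1 + ε))⌉₊ →
      ∀ m : ℕ,
        c₂ * (H / ε) ^ 2 *
            (n * t * Real.log (n * t + 2) * (1 + Real.log (H / ε)) + Real.log (1 / δ))
          ≤ m →
        ENNReal.ofReal (1 - δ) ≤
          (Measure.pi fun _ : Fin m => Measure.pi Fi)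
            {S | ∀ Ahat : TLevel n t,
              (∀ A : TLevel n t, (∑ j, A.Rev succ (S j)) ≤ ∑ j, Ahat.Rev succ (S j)) →
              ENNReal.ofReal (1 - ε) * OPT n (Set.Icc 1 H) (Measure.pi Fi) ≤
                ∫⁻ v, ENNReal.ofReal (Ahat.Rev succ v) ∂(Measure.pi Fi)} := by
  refine ⟨16, 288, by norm_num, by norm_num, ?_⟩
  intro n hn H hH ε δ hε hδ succ hsucc Fi hFi hat hsupp t ht m hm
  have hH0 : 0 < H := zero_lt_one.trans_le hH
  have hη : 0 < ε / 8 := by linarith [hε.1]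
  have htle : 16 * (1 / ε + Real.log H / Real.log (1 + ε)) ≤ t := ht ▸ Nat.le_ceil _
  have hrate : 0 < 1 / ε + Real.log H / Real.log (1 + ε) :=
    add_pos_of_pos_of_nonneg (one_div_pos.2 hε.1)
      (div_nonneg (Real.log_nonneg hH) (Real.log_nonneg (by linarith [hε.1])))
  have ht1 : 1 ≤ t := by rw [ht]; exact Nat.one_le_ceil_iff.2 (by positivity)
  have hn0 : (0 : ℝ) < n := by exact_mod_cast hn
  have ht0 : (0 : ℝ) < t := by exact_mod_cast ht1
  have hm0 : 0 < m := by
    have h1 : 0 < Real.log (1 / δ) :=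
      Real.log_pos (by rw [lt_div_iff₀ hδ.1]; linarith [hδ.2])
    have h2 : 0 ≤ Real.log (H / ε) :=
      Real.log_nonneg (by rw [le_div_iff₀ hε.1]; linarith [hε.2])
    have h3 : 0 ≤ Real.log (n * t + 2 : ℝ) := Real.log_nonneg (by nlinarith)
    have h4 : (0 : ℝ) < m := lt_of_lt_of_le (by have := hε.1; positivity) hm
    exact_mod_cast h4
  set B := gridAuction Fi hat hH0.le hη.le t with hBdef
  have hB : ∀ v, 0 ≤ B.Rev succ v := by
    intro v
    refine Finset.sum_nonneg fun i _ => ?_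
    split_ifs with h
    · obtain ⟨h1, -⟩ := (B.wins_iff_thr succ v i).1 h
      rw [B.payment_eq succ v i h1]
      exact (isLeast_optPrice (hat i) hH0.le _).1.1.1
    · exact le_rfl
  refine (measure_erm_ge Fi succ hat hH hsupp hη (N := ⌈n * t * H / (ε / 8)⌉₊)
    (Nat.ceil_pos.2 (by positivity)) (Nat.le_ceil _) hm0 hδ.1.le
    (card_pattern_mul_exp_le hn ht1 hH hε hδ.1 hδ.2 hm) B hB).trans ?_
  refine measure_mono fun S hS A hA => ?_
  have hopt := OPT_le_gridAuction (Fi := Fi) succ hat hH hsupp hη.le (le_virtualGrid hH hε htle)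
  have hone : 1 ≤ OPT n (Set.Icc 1 H) (Measure.pi Fi) := one_le_OPT hn
  have hcomp := hS A (hA B)
  have hintA := integrable_max_rev Fi succ hH hsupp A
  have hintB : Integrable (fun v => B.Rev succ v) (Measure.pi Fi) := by
    simpa only [max_eq_left (hB _)] using integrable_max_rev Fi succ hH hsupp B
  have hrevB : ∫⁻ v, ENNReal.ofReal (B.Rev succ v) ∂Measure.pi Fi =
      ENNReal.ofReal (∫ v, B.Rev succ v ∂Measure.pi Fi) :=
    (ofReal_integral_eq_lintegral_ofReal hintB (Filter.Eventually.of_forall hB)).symm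
  have hrevA : ∫⁻ v, ENNReal.ofReal (A.Rev succ v) ∂Measure.pi Fi =
      ENNReal.ofReal (∫ v, max (A.Rev succ v) 0 ∂Measure.pi Fi) := by
    rw [ofReal_integral_eq_lintegral_ofReal hintA
      (Filter.Eventually.of_forall fun v => le_max_right _ _)]
    simp [ENNReal.ofReal_max]
  have hb0 : 0 ≤ ∫ v, B.Rev succ v ∂Measure.pi Fi := integral_nonneg hB
  rw [← hBdef, hrevB, ← ENNReal.ofReal_mul (by linarith),
    ← ENNReal.ofReal_add (by positivity) hη.le] at hopt
  have hfin : OPT n (Set.Icc 1 H) (Measure.pi Fi) ≠ ⊤ :=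
    ne_top_of_le_ne_top ENNReal.ofReal_ne_top hopt
  rw [hrevA, ← ENNReal.ofReal_toReal hfin, ← ENNReal.ofReal_mul (by linarith [hε.2])]
  rw [← ENNReal.ofReal_toReal hfin] at hopt hone
  have h1 := (ENNReal.ofReal_le_ofReal_iff (by positivity)).1 hopt
  have h2 : 1 ≤ (OPT n (Set.Icc 1 H) (Measure.pi Fi)).toReal := by
    simpa using hone
  apply ENNReal.ofReal_le_ofReal
  obtain ⟨hε0, hε1⟩ := hε
  generalize (OPT n (Set.Icc 1 H) (Measure.pi Fi)).toReal = o at *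
  generalize ∫ v, B.Rev succ v ∂Measure.pi Fi = b at *
  generalize ∫ v, max (A.Rev succ v) 0 ∂Measure.pi Fi = a at *
  have h3 := mul_le_mul_of_nonneg_left h1 (show 0 ≤ 1 - ε / 8 by linarith)
  have h4 := mul_nonneg (sq_nonneg ε) hb0
  have h5 := mul_le_mul_of_nonneg_left h2 hε0.le
  nlinarith [sq_nonneg ε]
end

section
/- There is a universal constant c > 0 such that for all integers n ≥ 1 and t ≥ 1, every matroid M on the ground set {1,…,n}, and every fixed strict total order ≻ on {1,…,n}, the pseudo-dimension of the class of functions {Rev_A : A is a t-level matroid auction for M with tie-breaking order ≻}, viewed as real-valued functions on ℝⁿ, is at most c·n·t·ln(n·t + 2). -/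
open MeasureTheory
open scoped ENNReal

attribute [local instance] Classical.propDecidable

/-- A matroid on a ground set `E`, given by its independent sets: nonempty (contains ∅),
downward closed, and satisfying the exchange property. -/
structure SimpleMatroid (E : Type*) [DecidableEq E] where
  Indep : Finset E → Prop
  empty_indep : Indep ∅
  subset_indep : ∀ ⦃I J : Finset E⦄, Indep J → I ⊆ J → Indep I
  exchange : ∀ ⦃I J : Finset E⦄, Indep I → Indep J → I.card < J.card →
    ∃ e ∈ J, e ∉ I ∧ Indep (insert e I)

/-- Greedily scan a list of bidders, adding each eligible bidder whenever the
result stays independent in the matroid `M`. -/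
noncomputable def greedyAux {n : ℕ} (M : SimpleMatroid (Fin n)) (ok : Fin n → Prop) :
    List (Fin n) → Finset (Fin n) → Finset (Fin n)
  | [], W => W
  | i :: rest, W =>
      greedyAux M ok rest (if ok i ∧ M.Indep (insert i W) then insert i W else W)

/-- The winning set of the `t`-level matroid auction `(M, A, succ)` on profile `v`:
consider the bidders with level ≥ 0 in order of decreasing level, breaking ties within
a level by `succ`, and greedily add each bidder whenever independence in `M` is kept. -/
noncomputable def winSet {n t : ℕ} (M : SimpleMatroid (Fin n)) (A : TLevel n t)
    (succ : Fin n → Fin n → Prop) (v : Fin n → ℝ) : Finset (Fin n) :=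
  greedyAux M (fun i => 0 ≤ A.level i (v i))
    (List.insertionSort
      (fun i j => A.level j (v j) < A.level i (v i) ∨
        (A.level i (v i) = A.level j (v j) ∧ succ i j))
      (List.finRange n)) ∅

/-- The payment of bidder `i` in the `t`-level matroid auction: the infimum over bids
at which `i` would still be a winner (losers pay 0 in `RevM` below). -/
noncomputable def paymentM {n t : ℕ} (M : SimpleMatroid (Fin n)) (A : TLevel n t)
    (succ : Fin n → Fin n → Prop) (v : Fin n → ℝ) (i : Fin n) : ℝ :=
  sInf {b : ℝ | i ∈ winSet M A succ (Function.update v i b)}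

/-- The revenue of the `t`-level matroid auction on profile `v`: the sum of the
winners' critical payments. -/
noncomputable def RevM {n t : ℕ} (M : SimpleMatroid (Fin n)) (A : TLevel n t)
    (succ : Fin n → Fin n → Prop) (v : Fin n → ℝ) : ℝ :=
  ∑ i : Fin n, if i ∈ winSet M A succ v then paymentM M A succ v i else 0

/-- Pseudo-shattering of points `x` by a class `C` of real-valued functions. -/
def PseudoShatters {Q : Type*} (C : Set (Q → ℝ)) {m : ℕ} (x : Fin m → Q) : Prop :=
  ∃ r : Fin m → ℝ, ∀ T : Finset (Fin m), ∃ f ∈ C,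
    (∀ j, j ∈ T → r j ≤ f (x j)) ∧ (∀ j, j ∉ T → f (x j) < r j)

open Finset in
/-- Sauer–Shelah bound for a set system cut out of finitely many vectors by closed half-spaces. -/
theorem card_le_of_halfspaces {V : Type*} [AddCommGroup V] [Module ℝ V] [FiniteDimensional ℝ V]
    {m : ℕ} (w : Fin m → V) (F : Finset (Finset (Fin m)))
    (hF : ∀ T ∈ F, ∃ φ : V →ₗ[ℝ] ℝ, ∀ j, j ∈ T ↔ 0 ≤ φ (w j)) :
    F.card ≤ (m + 1) ^ Module.finrank ℝ V := by
  have hdim : ∀ s, F.Shatters s → s.card ≤ Module.finrank ℝ V := by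
    intro s hs
    by_contra! hlt
    have hdep : ¬ LinearIndependent ℝ (fun j : s => w j) := by
      intro h
      have := h.fintype_card_le_finrank
      rw [Fintype.card_coe] at this
      omega
    rw [Fintype.not_linearIndependent_iff] at hdep
    have key : ∀ g : s → ℝ, ∑ j, g j • w j = 0 → (∃ j, g j < 0) → False := by
      rintro g hg ⟨j₀, hj₀⟩
      obtain ⟨T, hT, hsT⟩ := hs (t := s.filter fun j => ∃ h : j ∈ s, 0 ≤ g ⟨j, h⟩)
        (filter_subset _ _)
      obtain ⟨φ, hφ⟩ := hF T hT
      have hmem : ∀ j : s, 0 ≤ g j ↔ 0 ≤ φ (w j) := by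
        intro j
        rw [← hφ]
        have := congrArg (fun u => (j : Fin m) ∈ u) hsT
        simpa using this.symm
      have h0 : ∑ j, g j * φ (w j) = 0 := by
        simpa using congrArg φ hg
      have hnn : ∀ j : s, 0 ≤ g j * φ (w j) := by
        intro j
        rcases le_or_gt 0 (g j) with h | h
        · exact mul_nonneg h ((hmem j).1 h)
        · have : φ (w j) < 0 := not_le.1 fun h' => absurd ((hmem j).2 h') (not_le.2 h)
          exact (mul_pos_of_neg_of_neg h this).le
      have hz := (sum_eq_zero_iff_of_nonneg fun j _ => hnn j).1 h0 j₀ (mem_univ _)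
      have : φ (w j₀) < 0 := not_le.1 fun h' => absurd ((hmem j₀).2 h') (not_le.2 hj₀)
      exact (mul_pos_of_neg_of_neg hj₀ this).ne' hz
    obtain ⟨g, hg, j, hj⟩ := hdep
    rcases lt_or_gt_of_ne hj with h | h
    · exact key g hg ⟨j, h⟩
    · refine key (fun j => -g j) ?_ ⟨j, neg_lt_zero.2 h⟩
      simpa using hg
  have hvc : F.vcDim ≤ Module.finrank ℝ V := by
    refine Finset.sup_le fun s hs => hdim s (mem_shatterer.1 hs)
  set d := Module.finrank ℝ V
  calc F.card ≤ F.shatterer.card := card_le_card_shatterer F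
    _ ≤ ∑ k ∈ Iic F.vcDim, (Fintype.card (Fin m)).choose k := card_shatterer_le_sum_vcDim
    _ ≤ ∑ k ∈ range (d + 1), m.choose k := by
        rw [Fintype.card_fin]
        refine sum_le_sum_of_subset fun k hk => ?_
        simp only [mem_Iic, mem_range] at hk ⊢
        omega
    _ ≤ ∑ k ∈ range (d + 1), m ^ k * 1 ^ (d - k) * d.choose k := by
        refine sum_le_sum fun k hk => ?_
        rw [one_pow, mul_one]
        exact (Nat.choose_le_pow m k).trans (Nat.le_mul_of_pos_right _
          (Nat.choose_pos (Nat.lt_succ_iff.1 (mem_range.1 hk))))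
    _ = (m + 1) ^ d := (add_pow m 1 d).symm

/-- The winning set as a function of the level vector. -/
noncomputable def levelWinSet {n : ℕ} (M : SimpleMatroid (Fin n))
    (succ : Fin n → Fin n → Prop) (L : Fin n → ℤ) : Finset (Fin n) :=
  greedyAux M (fun i => 0 ≤ L i)
    (List.insertionSort (fun i j => L j < L i ∨ (L i = L j ∧ succ i j)) (List.finRange n)) ∅

theorem winSet_eq_levelWinSet {n t : ℕ} (M : SimpleMatroid (Fin n)) (A : TLevel n t)
    (succ : Fin n → Fin n → Prop) (v : Fin n → ℝ) :
    winSet M A succ v = levelWinSet M succ fun i => A.level i (v i) := rfl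

theorem winSet_update {n t : ℕ} (M : SimpleMatroid (Fin n)) (A : TLevel n t)
    (succ : Fin n → Fin n → Prop) (v : Fin n → ℝ) (i : Fin n) (b : ℝ) :
    winSet M A succ (Function.update v i b) =
      levelWinSet M succ (Function.update (fun k => A.level k (v k)) i (A.level i b)) := by
  rw [winSet_eq_levelWinSet]
  congr 1
  funext k
  by_cases h : k = i
  · subst h; simp
  · simp [h]

theorem mem_or_ok_of_mem_greedyAux {n : ℕ} (M : SimpleMatroid (Fin n)) (ok : Fin n → Prop)
    (i : Fin n) (l : List (Fin n)) (W : Finset (Fin n)) (h : i ∈ greedyAux M ok l W) :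
    i ∈ W ∨ ok i := by
  induction l generalizing W with
  | nil => exact Or.inl h
  | cons k rest ih =>
    rw [greedyAux] at h
    rcases ih _ h with h | h
    · split_ifs at h with hk
      · rcases Finset.mem_insert.1 h with rfl | h
        · exact Or.inr hk.1
        · exact Or.inl h
      · exact Or.inl h
    · exact Or.inr h

theorem nonneg_of_mem_levelWinSet {n : ℕ} {M : SimpleMatroid (Fin n)}
    {succ : Fin n → Fin n → Prop} {L : Fin n → ℤ} {i : Fin n}
    (h : i ∈ levelWinSet M succ L) : 0 ≤ L i := by
  simpa using mem_or_ok_of_mem_greedyAux M _ i _ _ h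

/-- The infimum of the bids whose level lies in a set `S` of nonnegative levels is one of the
thresholds, and which one depends only on the levels of the thresholds themselves. -/
theorem exists_coeff_sInf_level {t : ℕ} (S : Set ℤ) (hS : ∀ k ∈ S, 0 ≤ k) (q : Fin t → ℤ) :
    ∃ a : Fin t → ℝ, ∀ {n : ℕ} (A : TLevel n t) (i : Fin n),
      (∀ τ, A.level i (A.thr i τ) = q τ) →
        sInf {b : ℝ | A.level i b ∈ S} = ∑ τ, a τ * A.thr i τ := by
  have attained : ∀ {n : ℕ} (A : TLevel n t) (i : Fin n) (b : ℝ), A.level i b ∈ S →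
      ∃ τ, A.thr i τ ≤ b ∧ A.level i (A.thr i τ) = A.level i b := by
    intro n A i b hb
    have hne : (Finset.univ.filter fun τ : Fin t => A.thr i τ ≤ b).Nonempty := by
      have := hS _ hb
      rw [TLevel.level] at this
      rw [← Finset.card_pos]
      omega
    obtain ⟨τ, hτ, hmax⟩ := Finset.exists_max_image _ (A.thr i) hne
    simp only [Finset.mem_filter, Finset.mem_univ, true_and] at hτ hmax
    refine ⟨τ, hτ, ?_⟩
    rw [TLevel.level, TLevel.level]
    congr 3
    ext σ
    simp only [Finset.mem_filter, Finset.mem_univ, true_and]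
    exact ⟨fun h => h.trans hτ, hmax σ⟩
  by_cases hne : (Finset.univ.filter fun τ => q τ ∈ S).Nonempty
  · obtain ⟨τ, hτ, hmin⟩ := Finset.exists_min_image _ id hne
    simp only [Finset.mem_filter, Finset.mem_univ, true_and, id] at hτ hmin
    refine ⟨Pi.single τ 1, fun {n} A i hq => ?_⟩
    have : IsLeast {b : ℝ | A.level i b ∈ S} (A.thr i τ) := by
      refine ⟨by simpa [hq] using hτ, fun b hb => ?_⟩
      obtain ⟨σ, hσ, hlev⟩ := attained A i b hb
      refine (A.mono i (hmin σ ?_)).trans hσ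
      rw [← hq, hlev]
      exact hb
    rw [this.csInf_eq, Finset.sum_eq_single τ] <;> simp +contextual
  · refine ⟨0, fun {n} A i hq => ?_⟩
    have : {b : ℝ | A.level i b ∈ S} = ∅ := by
      refine Set.eq_empty_iff_forall_notMem.2 fun b hb => hne ?_
      obtain ⟨σ, -, hlev⟩ := attained A i b hb
      refine ⟨σ, ?_⟩
      simp only [Finset.mem_filter, Finset.mem_univ, true_and]
      rw [← hq, hlev]
      exact hb
    simp [this]

/-- The revenue on a profile is a fixed linear function of the thresholds once the levels of the
bids and of the thresholds themselves are fixed. -/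
theorem exists_coeff_RevM {n t : ℕ} (M : SimpleMatroid (Fin n)) (succ : Fin n → Fin n → Prop)
    (L : Fin n → ℤ) (q : Fin n → Fin t → ℤ) :
    ∃ a : Fin n × Fin t → ℝ, ∀ (A : TLevel n t) (v : Fin n → ℝ),
      (∀ i, A.level i (v i) = L i) → (∀ i τ, A.level i (A.thr i τ) = q i τ) →
        RevM M A succ v = ∑ k, a k * A.thr k.1 k.2 := by
  choose a ha using fun i => exists_coeff_sInf_level
    {k : ℤ | i ∈ levelWinSet M succ (Function.update L i k)}
    (fun k hk => by simpa using nonneg_of_mem_levelWinSet hk) (q i)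
  refine ⟨fun k => if k.1 ∈ levelWinSet M succ L then a k.1 k.2 else 0, fun A v hL hq => ?_⟩
  obtain rfl : (fun i => A.level i (v i)) = L := funext hL
  rw [RevM, Fintype.sum_prod_type]
  refine Finset.sum_congr rfl fun i _ => ?_
  rw [winSet_eq_levelWinSet]
  split_ifs with h
  · simp only [h, if_true]
    rw [← ha i A i (hq i), paymentM]
    simp only [winSet_update, Set.mem_ofPred_eq]
  · simp [h]

/-- The number of sample values reaching a threshold determines which ones do. -/
theorem filter_le_eq_of_card_eq {m : ℕ} (x : Fin m → ℝ) (a b : ℝ)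
    (h : (Finset.univ.filter fun j => a ≤ x j).card = (Finset.univ.filter fun j => b ≤ x j).card) :
    (Finset.univ.filter fun j => a ≤ x j) = Finset.univ.filter fun j => b ≤ x j := by
  rcases le_total a b with hab | hab
  · refine (Finset.eq_of_subset_of_card_le (fun j => ?_) h.le).symm
    simpa using hab.trans
  · refine Finset.eq_of_subset_of_card_le (fun j => ?_) h.ge
    simpa using hab.trans

/-- The combinatorial type of an auction relative to a sample: for each threshold, the number of
sample values reaching it and the number of thresholds of the same bidder not exceeding it. -/
noncomputable def auctionType {n t m : ℕ} (v : Fin m → Fin n → ℝ) (A : TLevel n t) :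
    Fin n × Fin t → Fin (m + 1) × Fin (t + 1) := fun k =>
  (⟨(Finset.univ.filter fun j => A.thr k.1 k.2 ≤ v j k.1).card,
      Nat.lt_succ_of_le ((Finset.card_le_univ _).trans_eq (Fintype.card_fin m))⟩,
    ⟨(Finset.univ.filter fun σ => A.thr k.1 σ ≤ A.thr k.1 k.2).card,
      Nat.lt_succ_of_le ((Finset.card_le_univ _).trans_eq (Fintype.card_fin t))⟩)

theorem level_eq_of_auctionType_eq {n t m : ℕ} {v : Fin m → Fin n → ℝ} {A B : TLevel n t}
    (h : auctionType v A = auctionType v B) (j : Fin m) (i : Fin n) :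
    A.level i (v j i) = B.level i (v j i) := by
  rw [TLevel.level, TLevel.level]
  congr 3
  ext τ
  have h1 := congrArg (fun p => (p (i, τ)).1.val) h
  have h2 := filter_le_eq_of_card_eq (fun j => v j i) _ _ h1
  simpa using congrArg (fun s => j ∈ s) h2

theorem level_thr_eq_of_auctionType_eq {n t m : ℕ} {v : Fin m → Fin n → ℝ} {A B : TLevel n t}
    (h : auctionType v A = auctionType v B) (i : Fin n) (τ : Fin t) :
    A.level i (A.thr i τ) = B.level i (B.thr i τ) := by
  have h1 : (Finset.univ.filter fun σ => A.thr i σ ≤ A.thr i τ).card =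
      (Finset.univ.filter fun σ => B.thr i σ ≤ B.thr i τ).card :=
    congrArg (fun p => (p (i, τ)).2.val) h
  rw [TLevel.level, TLevel.level, h1]

theorem two_pow_le_of_pseudoShatters {n t m : ℕ} (M : SimpleMatroid (Fin n))
    (succ : Fin n → Fin n → Prop) (v : Fin m → Fin n → ℝ)
    (h : PseudoShatters {g | ∃ A : TLevel n t, g = RevM M A succ} v) :
    2 ^ m ≤ ((m + 1) * (t + 1)) ^ (n * t) * (m + 1) ^ (n * t + 1) := by
  obtain ⟨r, hr⟩ := h
  have hr' : ∀ T : Finset (Fin m), ∃ A : TLevel n t, ∀ j, j ∈ T ↔ r j ≤ RevM M A succ (v j) := by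
    intro T
    obtain ⟨f, ⟨A, rfl⟩, h1, h2⟩ := hr T
    refine ⟨A, fun j => ⟨h1 j, fun h => ?_⟩⟩
    by_contra hj
    exact absurd h (not_le.2 (h2 j hj))
  choose A hA using hr'
  have hfib : ∀ p ∈ (Finset.univ : Finset (Fin n × Fin t → Fin (m + 1) × Fin (t + 1))),
      (Finset.univ.filter fun T => auctionType v (A T) = p).card ≤ (m + 1) ^ (n * t + 1) := by
    intro p _
    rcases (Finset.univ.filter fun T => auctionType v (A T) = p).eq_empty_or_nonempty with h | h
    · simp [h]
    obtain ⟨T₀, hT₀⟩ := h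
    simp only [Finset.mem_filter, Finset.mem_univ, true_and] at hT₀
    choose a ha using fun j => exists_coeff_RevM M succ (fun i => (A T₀).level i (v j i))
      (fun i τ => (A T₀).level i ((A T₀).thr i τ))
    have hcard := card_le_of_halfspaces (V := (Fin n × Fin t → ℝ) × ℝ) (fun j => (a j, r j))
      (Finset.univ.filter fun T => auctionType v (A T) = p) ?_
    · simpa using hcard
    intro T hT
    simp only [Finset.mem_filter, Finset.mem_univ, true_and] at hT
    have hty := hT.trans hT₀.symm
    refine ⟨(∑ k, (A T).thr k.1 k.2 • LinearMap.proj k) ∘ₗ LinearMap.fst ℝ _ _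
      - LinearMap.snd ℝ _ _, fun j => ?_⟩
    rw [hA, ha j (A T) (v j) (level_eq_of_auctionType_eq hty j)
      (level_thr_eq_of_auctionType_eq hty)]
    simp [mul_comm]
  have := Finset.card_le_mul_card_image_of_maps_to
    (s := (Finset.univ : Finset (Finset (Fin m)))) (f := fun T => auctionType v (A T))
    (t := Finset.univ) (fun _ _ => Finset.mem_univ _) _ hfib
  simpa [mul_comm] using this

theorem le_mul_log_of_two_pow_le {m N s : ℕ} (hN : 1 ≤ N) (hs : s ≤ N)
    (h : 2 ^ m ≤ ((m + 1) * (s + 1)) ^ N * (m + 1) ^ (N + 1)) :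
    (m : ℝ) ≤ 40 * (N * Real.log (N + 2)) := by
  have hN' : (1 : ℝ) ≤ N := by exact_mod_cast hN
  have hs' : (s : ℝ) ≤ N := by exact_mod_cast hs
  have hm : (0 : ℝ) ≤ m := Nat.cast_nonneg m
  have hs0 : (0 : ℝ) ≤ s := Nat.cast_nonneg s
  have hR : (2 : ℝ) ^ m ≤ (((m : ℝ) + 1) * (s + 1)) ^ N * ((m : ℝ) + 1) ^ (N + 1) := by
    exact_mod_cast h
  have hlog := Real.log_le_log (by positivity) hR
  rw [Real.log_mul (by positivity) (by positivity), Real.log_pow, Real.log_pow, Real.log_pow,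
    Real.log_mul (by positivity) (by positivity)] at hlog
  push_cast at hlog
  set l := Real.log (N + 2) with hl
  have h1 : Real.log (s + 1) ≤ l := Real.log_le_log (by positivity) (by linarith)
  have hl1 : 1 ≤ l := by
    rw [hl, Real.le_log_iff_exp_le (by positivity)]
    linarith [Real.exp_one_lt_d9]
  have h2 : Real.log (m + 1) ≤ (m + 1) / (12 * N) + 4 * l - 1 := by
    have e := Real.log_le_sub_one_of_pos (x := (m + 1) / (12 * N)) (by positivity)
    rw [Real.log_div (by positivity) (by positivity)] at e
    have e2 : Real.log (12 * N) ≤ Real.log (((N : ℝ) + 2) ^ 4) := by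
      refine Real.log_le_log (by positivity) ?_
      nlinarith [sq_nonneg (N : ℝ), pow_nonneg (Nat.cast_nonneg (α := ℝ) N) 3,
        pow_nonneg (Nat.cast_nonneg (α := ℝ) N) 4]
    rw [Real.log_pow] at e2
    push_cast at e2
    linarith
  have hlm : 0 ≤ Real.log ((m : ℝ) + 1) := Real.log_nonneg (by linarith)
  have h3 : (N : ℝ) * Real.log (m + 1) ≤ (m + 1) / 12 + N * (4 * l - 1) := by
    calc (N : ℝ) * Real.log (m + 1) ≤ N * ((m + 1) / (12 * N) + 4 * l - 1) := by gcongr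
      _ = (m + 1) / 12 + N * (4 * l - 1) := by field_simp; ring
  have h4 : Real.log ((m : ℝ) + 1) ≤ N * Real.log (m + 1) := le_mul_of_one_le_left hlm hN'
  have h5 : (N : ℝ) * Real.log (s + 1) ≤ N * l := by gcongr
  have h6 : (m : ℝ) * 0.69 ≤ m * Real.log 2 := by
    gcongr
    linarith [Real.log_two_gt_d9]
  have h7 : (N : ℝ) ≤ N * l := le_mul_of_one_le_right (by positivity) hl1
  nlinarith

/-- There is a universal constant `c > 0` bounding the pseudo-dimension of the class of
revenue functions of `t`-level matroid auctions (for any matroid `M` on `n` bidders and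
any strict total tie-breaking order) by `c · n · t · ln(nt + 2)`. -/
theorem pseudoDim_tlevel_matroid :
    ∃ c : ℝ, 0 < c ∧
      ∀ n t : ℕ, 1 ≤ n → 1 ≤ t →
      ∀ M : SimpleMatroid (Fin n),
      ∀ succ : Fin n → Fin n → Prop, IsStrictTotalOrder (Fin n) succ →
      ∀ (m : ℕ) (v : Fin m → (Fin n → ℝ)),
        PseudoShatters {g | ∃ A : TLevel n t, g = RevM M A succ} v →
        (m : ℝ) ≤ c * n * t * Real.log (n * t + 2) := by
  refine ⟨40, by norm_num, fun n t hn ht M succ _ m v h => ?_⟩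
  have := le_mul_log_of_two_pow_le (Nat.mul_pos hn ht) (Nat.le_mul_of_pos_left t hn)
    (two_pow_le_of_pseudoShatters M succ v h)
  push_cast at this
  linarith
end

section
/- Let M be a matroid on a finite ground set E and let w : E → ℝ be a nonnegative weight function. Let Opt be an independent set of M maximizing Σ_{e∈Opt} w(e) over all independent sets of M, and let B be any independent set of M with |B| = |Opt| = k. List the elements of Opt as o₁,…,o_k and the elements of B as b₁,…,b_k, each in nonincreasing order of weight. Then w(o_i) ≥ w(b_i) for every i ∈ {1,…,k}. -/
attribute [local instance] Classical.propDecidable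

/-- An independent set extends, by elements of another independent set `J` that is at least as
large, to an independent set of the cardinality of `J`. -/
theorem SimpleMatroid.exists_indep_superset_card_eq {E : Type*} [DecidableEq E]
    (M : SimpleMatroid E) {I J : Finset E} (hI : M.Indep I) (hJ : M.Indep J)
    (hIJ : I.card ≤ J.card) :
    ∃ K, I ⊆ K ∧ K ⊆ I ∪ J ∧ M.Indep K ∧ K.card = J.card := by
  induction hn : J.card - I.card generalizing I with
  | zero => exact ⟨I, subset_rfl, Finset.subset_union_left, hI, by omega⟩
  | succ n ih =>
    obtain ⟨e, heJ, heI, he⟩ := M.exchange hI hJ (by omega)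
    have hcard := Finset.card_insert_of_notMem heI
    obtain ⟨K, hIK, hKJ, hK, hKcard⟩ := ih he (by omega) (by omega)
    refine ⟨K, (Finset.subset_insert e I).trans hIK, hKJ.trans ?_, hK, hKcard⟩
    rw [Finset.insert_union]
    exact Finset.insert_subset (Finset.mem_union_right _ heJ) subset_rfl

/-- In a matroid, if `Opt` is a maximum-weight independent set (for nonnegative weights)
and `B` is any independent set of the same cardinality `k`, then listing both sets in
nonincreasing order of weight, the `i`-th element of `Opt` outweighs the `i`-th element
of `B`, for every `i`. -/
theorem matroid_sorted_domination
    (E : Type) [DecidableEq E] [Fintype E] (M : SimpleMatroid E)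
    (w : E → ℝ) (hw : ∀ e, 0 ≤ w e)
    (Opt B : Finset E) (hOptIndep : M.Indep Opt)
    (hOptMax : ∀ I : Finset E, M.Indep I → (∑ e ∈ I, w e) ≤ ∑ e ∈ Opt, w e)
    (hBIndep : M.Indep B)
    (k : ℕ) (hOptCard : Opt.card = k) (hBCard : B.card = k)
    (o b : Fin k → E)
    (hoInj : Function.Injective o) (hbInj : Function.Injective b)
    (hoRange : ∀ e, e ∈ Opt ↔ ∃ j, o j = e)
    (hbRange : ∀ e, e ∈ B ↔ ∃ j, b j = e)
    (hoSorted : Antitone fun j => w (o j))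
    (hbSorted : Antitone fun j => w (b j)) :
    ∀ i : Fin k, w (b i) ≤ w (o i) := by
  intro i
  by_contra! hlt
  set A := (Finset.Iio i).image o with hA
  set C := (Finset.Iic i).image b with hC
  have hAOpt : A ⊆ Opt := by
    intro x hx
    obtain ⟨j, -, rfl⟩ := Finset.mem_image.1 hx
    exact (hoRange _).2 ⟨j, rfl⟩
  have hCB : C ⊆ B := by
    intro x hx
    obtain ⟨j, -, rfl⟩ := Finset.mem_image.1 hx
    exact (hbRange _).2 ⟨j, rfl⟩
  have hAcard : A.card = i := by
    rw [hA, Finset.card_image_of_injective _ hoInj, Fin.card_Iio]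
  have hCcard : C.card = i + 1 := by
    rw [hC, Finset.card_image_of_injective _ hbInj, Fin.card_Iic]
  have hlight : ∀ f ∈ Opt, f ∉ A → w f ≤ w (o i) := by
    intro f hf hfA
    obtain ⟨j, rfl⟩ := (hoRange f).1 hf
    refine hoSorted (not_lt.1 fun hj => hfA ?_)
    exact Finset.mem_image_of_mem o (Finset.mem_Iio.2 hj)
  obtain ⟨e, heC, heA, he⟩ := M.exchange (M.subset_indep hOptIndep hAOpt)
    (M.subset_indep hBIndep hCB) (by omega)
  have hwe : w (o i) < w e := by
    obtain ⟨j, hj, rfl⟩ := Finset.mem_image.1 heC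
    exact hlt.trans_le (hbSorted (Finset.mem_Iic.1 hj))
  have heOpt : e ∉ Opt := fun h => (hlight e h heA).not_gt hwe
  have hins := Finset.card_insert_of_notMem heA
  obtain ⟨K, hAK, hKOpt, hK, hKcard⟩ := M.exists_indep_superset_card_eq he hOptIndep
    (by have := i.isLt; omega)
  have hKsub : K ⊆ insert e Opt := by
    rwa [Finset.insert_union, Finset.union_eq_right.2 hAOpt] at hKOpt
  have hdiff : (insert e Opt \ K).card = 1 := by
    rw [Finset.card_sdiff_of_subset hKsub, Finset.card_insert_of_notMem heOpt]
    omega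
  obtain ⟨f, hf⟩ := Finset.card_eq_one.1 hdiff
  have hfmem : f ∈ insert e Opt \ K := by simp [hf]
  obtain ⟨hfOpt, hfK⟩ := Finset.mem_sdiff.1 hfmem
  have hwf : w f ≤ w (o i) := by
    refine hlight f (Finset.mem_of_mem_insert_of_ne hfOpt ?_)
      fun h => hfK (hAK (Finset.mem_insert_of_mem h))
    rintro rfl
    exact hfK (hAK (Finset.mem_insert_self _ _))
  have hsum := Finset.sum_sdiff (f := w) hKsub
  rw [hf, Finset.sum_singleton, Finset.sum_insert heOpt] at hsum
  linarith [hOptMax K hK]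
end
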